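/- For every integer r ≥ 3 there exists an r-graph F whose uniform Turán density equals 1/4; that is, there exists a locally 1/4-dense sequence of F-free r-graphs, and for every ε > 0 there is no locally (1/4+ε)-dense sequence of F-free r-graphs. -/

import Mathlib

namespace UTD

/-- An `r`-uniform hypergraph on a finite vertex set of naturals. -/
structure RGraph (r : ℕ) where
  verts : Finset ℕ
  edges : Finset (Finset ℕ)
  edges_subset : ∀ e ∈ edges, e ⊆ verts
  edges_card : ∀ e ∈ edges, e.card = r

/-- `F` is a subgraph of `H`: an injection of `V(F)` into `V(H)` mapping edges to edges. -/
def IsSubgraph {r : ℕ} (F H : RGraph r) : Prop :=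
  ∃ φ : ℕ → ℕ, Set.InjOn φ ↑F.verts ∧ (∀ v ∈ F.verts, φ v ∈ H.verts) ∧
    ∀ e ∈ F.edges, e.image φ ∈ H.edges

/-- `H` is `(d, ε)`-dense: every `S ⊆ V(H)` with `|S| ≥ ε|V(H)|` spans at least
`(d - ε) * C(|S|, r)` edges. -/
def IsDense {r : ℕ} (H : RGraph r) (d ε : ℝ) : Prop :=
  ∀ S ⊆ H.verts, ε * H.verts.card ≤ S.card →
    (d - ε) * (S.card.choose r : ℝ) ≤ ((H.edges.filter (fun e => e ⊆ S)).card : ℝ)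

/-- A sequence of `r`-graphs is locally `d`-dense. -/
def LocallyDense {r : ℕ} (H : ℕ → RGraph r) (d : ℝ) : Prop :=
  ∃ ε : ℕ → ℝ, (∀ n, 0 < ε n) ∧
    Filter.Tendsto ε Filter.atTop (nhds 0) ∧
    Filter.Tendsto (fun n => (H n).verts.card) Filter.atTop Filter.atTop ∧
    ∀ n, IsDense (H n) d (ε n)

/-- The role (set of ranks, 1-indexed) that the elements of `p` play within the
set `e`, with respect to the order given by `ord`. -/
def role (ord : ℕ → ℕ) (e p : Finset ℕ) : Finset ℕ :=
  p.image (fun v => (e.filter (fun w => ord w < ord v)).card + 1)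

/-- Twin pair of edges: distinct edges intersecting in exactly two vertices. -/
def IsTwin {r : ℕ} (F : RGraph r) (e f : Finset ℕ) : Prop :=
  e ∈ F.edges ∧ f ∈ F.edges ∧ e ≠ f ∧ (e ∩ f).card = 2

/-- Quasi-linear: every edge `e` has a unique twin, and all other edges meet `e`
in at most one vertex. -/
def QuasiLinear {r : ℕ} (F : RGraph r) : Prop :=
  ∀ e ∈ F.edges, ∃ f ∈ F.edges, f ≠ e ∧ (e ∩ f).card = 2 ∧
    ∀ f' ∈ F.edges, f' ≠ e → f' ≠ f → (e ∩ f').card ≤ 1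

/-- `F` with the vertex order `ord` is consistently ordered. -/
def ConsistentlyOrdered {r : ℕ} (F : RGraph r) (ord : ℕ → ℕ) : Prop :=
  ∀ e f, IsTwin F e f → role ord e (e ∩ f) = role ord f (e ∩ f)

/-- `F` is consistent: some linear order of its vertices makes it consistently ordered. -/
def Consistent {r : ℕ} (F : RGraph r) : Prop :=
  ∃ ord : ℕ → ℕ, Set.InjOn ord ↑F.verts ∧ ConsistentlyOrdered F ord

/-- `p` is the head of the edge `e`: its two smallest vertices w.r.t. `ord`. -/
def IsHead (ord : ℕ → ℕ) (e p : Finset ℕ) : Prop :=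
  p ⊆ e ∧ p.card = 2 ∧ ∀ u ∈ p, ∀ w ∈ e, w ∉ p → ord u < ord w

/-- `p` is the tail of the edge `e`: its two largest vertices w.r.t. `ord`. -/
def IsTail (ord : ℕ → ℕ) (e p : Finset ℕ) : Prop :=
  p ⊆ e ∧ p.card = 2 ∧ ∀ u ∈ p, ∀ w ∈ e, w ∉ p → ord w < ord u

/-- Head-tail-mixing: for every linear order of the vertex set there are edges
`e, f` such that the head of `e` equals the tail of `f`. -/
def HeadTailMixing {r : ℕ} (F : RGraph r) : Prop :=
  ∀ ord : ℕ → ℕ, Set.InjOn ord ↑F.verts →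
    ∃ e ∈ F.edges, ∃ f ∈ F.edges, ∃ p : Finset ℕ, IsHead ord e p ∧ IsTail ord f p

inductive Letter : Type
  | X | Y | Z
  deriving DecidableEq

/-- A descriptive sequence of order `r`: `2r - 2` letters, among which `r - 2`
are `X`, `r - 2` are `Y`, and two are `Z`. -/
def IsDescSeq (r : ℕ) (σ : Fin (2 * r - 2) → Letter) : Prop :=
  (Finset.univ.filter (fun i => σ i = Letter.X)).card = r - 2 ∧
  (Finset.univ.filter (fun i => σ i = Letter.Y)).card = r - 2 ∧
  (Finset.univ.filter (fun i => σ i = Letter.Z)).card = 2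

/-- The descriptive sequence `XX…XZZYY…Y`. -/
def headTailSeq (r : ℕ) : Fin (2 * r - 2) → Letter := fun i =>
  if (i : ℕ) < r - 2 then Letter.X
  else if (i : ℕ) < r then Letter.Z
  else Letter.Y

/-- The role (set of ranks, 1-indexed) played by the positions of the two `Z`s
within the positions carrying letters different from `avoid`. -/
def seqRole (r : ℕ) (σ : Fin (2 * r - 2) → Letter) (avoid : Letter) : Finset ℕ :=
  (Finset.univ.filter (fun i => σ i = Letter.Z)).image
    (fun i => (Finset.univ.filter (fun j => σ j ≠ avoid ∧ j < i)).card + 1)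

/-- A descriptive sequence is consistent if its two `Z`s play the same role among
the `X/Z` positions as among the `Y/Z` positions. -/
def SeqConsistent (r : ℕ) (σ : Fin (2 * r - 2) → Letter) : Prop :=
  seqRole r σ Letter.Y = seqRole r σ Letter.X

def SeqInconsistent (r : ℕ) (σ : Fin (2 * r - 2) → Letter) : Prop :=
  IsDescSeq r σ ∧ ¬ SeqConsistent r σ

/-- The descriptive sequence `σ` describes the pair of edges `{e, f}` under the
vertex order `ord`. -/
def Describes (r : ℕ) (σ : Fin (2 * r - 2) → Letter) (ord : ℕ → ℕ)
    (e f : Finset ℕ) : Prop :=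
  ∃ w : Fin (2 * r - 2) → ℕ,
    (∀ i j : Fin (2 * r - 2), i < j → ord (w i) < ord (w j)) ∧
    (∀ v : ℕ, v ∈ e ∪ f ↔ ∃ i, w i = v) ∧
    (((∀ i, w i ∈ e ↔ σ i ≠ Letter.Y) ∧ (∀ i, w i ∈ f ↔ σ i ≠ Letter.X)) ∨
     ((∀ i, w i ∈ e ↔ σ i ≠ Letter.X) ∧ (∀ i, w i ∈ f ↔ σ i ≠ Letter.Y)))

/-- A quasi-linear `r`-graph admits the descriptive sequence `σ`: there is a
linear order of its vertices in which every twin pair of edges is described by `σ`. -/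
def AdmitsSeq {r : ℕ} (F : RGraph r) (σ : Fin (2 * r - 2) → Letter) : Prop :=
  ∃ ord : ℕ → ℕ, Set.InjOn ord ↑F.verts ∧
    ∀ e f, IsTwin F e f → Describes r σ ord e f

/-- Linear hypergraph: any two distinct edges intersect in at most one vertex. -/
def LinearGraph {r : ℕ} (H : RGraph r) : Prop :=
  ∀ e ∈ H.edges, ∀ f ∈ H.edges, e ≠ f → (e ∩ f).card ≤ 1

/-- Nowhere-empty sequence of `r`-graphs. -/
def NowhereEmpty {r : ℕ} (H : ℕ → RGraph r) : Prop :=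
  ∀ c : ℝ, 0 < c → ∃ n₀ : ℕ, ∀ n ≥ n₀, ∀ S : Fin r → Finset ℕ,
    (∀ i, S i ⊆ (H n).verts) →
    (∀ i j, i ≠ j → Disjoint (S i) (S j)) →
    (∀ i, c * (H n).verts.card ≤ (S i).card) →
    ∃ e ∈ (H n).edges, ∀ i, (e ∩ S i).Nonempty

/-- A `(k, r)`-reduced hypergraph. -/
structure ReducedGraph (k r : ℕ) where
  part : Fin k → Fin k → Finset ℕ
  part_symm : ∀ i j, part i j = part j i
  part_disj : ∀ i j i' j' : Fin k, i < j → i' < j' → (i, j) ≠ (i', j') →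
    Disjoint (part i j) (part i' j')
  edges : Finset (Finset ℕ)
  edges_card : ∀ e ∈ edges, e.card = r.choose 2
  edges_struct : ∀ e ∈ edges, ∃ t : Fin r → Fin k, StrictMono t ∧
    ∀ a b : Fin r, a < b → (e ∩ part (t a) (t b)).card = 1

/-- The constituent `A_{t 0, …, t (r-1)}` of a reduced hypergraph. -/
def constituent {k r : ℕ} (H : ReducedGraph k r) (t : Fin r → Fin k) :
    Finset (Finset ℕ) :=
  H.edges.filter (fun e => ∀ a b : Fin r, a < b → (e ∩ H.part (t a) (t b)).card = 1)

/-- A reduced hypergraph has density at least `d`. -/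
def HasDensity {k r : ℕ} (H : ReducedGraph k r) (d : ℝ) : Prop :=
  ∀ t : Fin r → Fin k, StrictMono t →
    d * ∏ p ∈ Finset.univ.filter (fun p : Fin r × Fin r => p.1 < p.2),
      ((H.part (t p.1) (t p.2)).card : ℝ) ≤ ((constituent H t).card : ℝ)

/-- The `(2r-2)`-tuple of indices `t` admits the descriptive sequence `σ` in the
reduced hypergraph `H`. -/
def TupleAdmits {k r : ℕ} (H : ReducedGraph k r) (σ : Fin (2 * r - 2) → Letter)
    (t : Fin (2 * r - 2) → Fin k) : Prop :=
  ∃ tx ty : Fin r → Fin k, StrictMono tx ∧ StrictMono ty ∧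
    Set.range tx = t '' {i | σ i ≠ Letter.Y} ∧
    Set.range ty = t '' {i | σ i ≠ Letter.X} ∧
    ∃ eX ∈ constituent H tx, ∃ eY ∈ constituent H ty, (eX ∩ eY).card = 1

/-- The uniform Turán density threshold `C(r,2)^(-C(r,2))`. -/
noncomputable def piR (r : ℕ) : ℝ := ((r.choose 2 : ℝ) ^ (r.choose 2))⁻¹


theorem ramsey (m : ℕ) : ∀ a b : ℕ, ∃ K : ℕ, ∀ S : Finset ℕ, K ≤ S.card → ∀ col : Finset ℕ → Prop,
    (∃ A ⊆ S, A.card = a ∧ ∀ B ⊆ A, B.card = m → col B) ∨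
    (∃ A ⊆ S, A.card = b ∧ ∀ B ⊆ A, B.card = m → ¬ col B) := by
  induction m with
  | zero =>
    intro a b
    refine ⟨max a b, fun S hS col => ?_⟩
    by_cases h : col ∅
    · left
      obtain ⟨A, hA, hc⟩ := Finset.exists_subset_card_eq (le_trans (le_max_left a b) hS)
      refine ⟨A, hA, hc, fun B _ hB => ?_⟩
      rw [Finset.card_eq_zero] at hB
      rwa [hB]
    · right
      obtain ⟨A, hA, hc⟩ := Finset.exists_subset_card_eq (le_trans (le_max_right a b) hS)
      refine ⟨A, hA, hc, fun B _ hB => ?_⟩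
      rw [Finset.card_eq_zero] at hB
      rwa [hB]
  | succ m ih =>
    suffices H : ∀ n a b : ℕ, a + b = n → ∃ K : ℕ, ∀ S : Finset ℕ, K ≤ S.card →
        ∀ col : Finset ℕ → Prop,
        (∃ A ⊆ S, A.card = a ∧ ∀ B ⊆ A, B.card = m + 1 → col B) ∨
        (∃ A ⊆ S, A.card = b ∧ ∀ B ⊆ A, B.card = m + 1 → ¬ col B) by
      intro a b
      exact H _ a b rfl
    intro n
    induction n with
    | zero =>
      intro a b hab
      refine ⟨0, fun S _ col => Or.inl ⟨∅, by simp, by simp; omega, ?_⟩⟩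
      intro B hB hc
      rw [Finset.subset_empty] at hB
      simp [hB] at hc
    | succ n ihn =>
      intro a b hab
      rcases a with _ | a
      · refine ⟨0, fun S _ col => Or.inl ⟨∅, by simp, by simp, ?_⟩⟩
        intro B hB hc
        rw [Finset.subset_empty] at hB
        simp [hB] at hc
      rcases b with _ | b
      · refine ⟨0, fun S _ col => Or.inr ⟨∅, by simp, by simp, ?_⟩⟩
        intro B hB hc
        rw [Finset.subset_empty] at hB
        simp [hB] at hc
      obtain ⟨K1, h1⟩ := ihn a (b + 1) (by omega)
      obtain ⟨K2, h2⟩ := ihn (a + 1) b (by omega)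
      obtain ⟨K, hK⟩ := ih K1 K2
      refine ⟨K + 1, fun S hS col => ?_⟩
      obtain ⟨v, hv⟩ : S.Nonempty := by
        rw [← Finset.card_pos]; omega
      have hS' : K ≤ (S.erase v).card := by
        rw [Finset.card_erase_of_mem hv]; omega
      have key : ∀ (A A' : Finset ℕ) (Q : Finset ℕ → Prop), A' ⊆ A → v ∉ A →
          (∀ B ⊆ A, B.card = m → Q (insert v B)) → (∀ B ⊆ A', B.card = m + 1 → Q B) →
          ∀ B ⊆ insert v A', B.card = m + 1 → Q B := by
        intro A A' Q hA' hvA h1 h2 B hB hc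
        by_cases hvB : v ∈ B
        · have := h1 (B.erase v) (by
            intro x hx
            have hx' := hB (Finset.mem_of_mem_erase hx)
            rcases Finset.mem_insert.1 hx' with h | h
            · exact absurd h (Finset.ne_of_mem_erase hx)
            · exact hA' h) (by rw [Finset.card_erase_of_mem hvB]; omega)
          rwa [Finset.insert_erase hvB] at this
        · refine h2 B ?_ hc
          intro x hx
          rcases Finset.mem_insert.1 (hB hx) with h | h
          · exact absurd (h ▸ hx) hvB
          · exact h
      rcases hK (S.erase v) hS' (fun B => col (insert v B)) with ⟨A, hA, hc, hcol⟩ | ⟨A, hA, hc, hcol⟩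
      · have hvA : v ∉ A := fun h => by simpa using hA h
        rcases h1 A hc.ge col with ⟨A', hA', hc', hcol'⟩ | ⟨A', hA', hc', hcol'⟩
        · left
          refine ⟨insert v A', ?_, ?_, key A A' col hA' hvA hcol hcol'⟩
          · intro x hx
            rcases Finset.mem_insert.1 hx with h | h
            · exact h ▸ hv
            · exact Finset.mem_of_mem_erase (hA (hA' h))
          · rw [Finset.card_insert_of_notMem (fun h => hvA (hA' h)), hc']
        · right
          exact ⟨A', (hA'.trans hA).trans (Finset.erase_subset _ _), hc', hcol'⟩
      · have hvA : v ∉ A := fun h => by simpa using hA h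
        rcases h2 A hc.ge col with ⟨A', hA', hc', hcol'⟩ | ⟨A', hA', hc', hcol'⟩
        · left
          exact ⟨A', (hA'.trans hA).trans (Finset.erase_subset _ _), hc', hcol'⟩
        · right
          refine ⟨insert v A', ?_, ?_, key A A' (fun B => ¬ col B) hA' hvA hcol hcol'⟩
          · intro x hx
            rcases Finset.mem_insert.1 hx with h | h
            · exact h ▸ hv
            · exact Finset.mem_of_mem_erase (hA (hA' h))
          · rw [Finset.card_insert_of_notMem (fun h => hvA (hA' h)), hc']

/-- Resampling identity. -/
theorem resample {ι κ α : Type*} [Fintype ι] [Fintype κ] [DecidableEq ι] [DecidableEq κ]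
    (U : ι → Finset α) (τ : κ → ι) (hτ : Function.Injective τ) (g : (ι → α) → ℝ) :
    ∑ x ∈ Fintype.piFinset U, ∑ z ∈ Fintype.piFinset (fun j => U (τ j)),
      g (Function.extend τ z x) = (∏ j, ((U (τ j)).card : ℝ)) * ∑ x ∈ Fintype.piFinset U, g x := by
  have hext : ∀ x ∈ Fintype.piFinset U, ∀ z ∈ Fintype.piFinset (fun j => U (τ j)),
      Function.extend τ z x ∈ Fintype.piFinset U := by
    intro x hx z hz
    rw [Fintype.mem_piFinset] at *
    intro i
    by_cases h : ∃ j, τ j = i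
    · obtain ⟨j, rfl⟩ := h
      rw [hτ.extend_apply]
      exact hz j
    · rw [Function.extend_apply' _ _ _ h]
      exact hx i
  have hcomp : ∀ x ∈ Fintype.piFinset U, (x ∘ τ) ∈ Fintype.piFinset (fun j => U (τ j)) := by
    intro x hx
    rw [Fintype.mem_piFinset] at *
    exact fun j => hx (τ j)
  have hinv : ∀ (x : ι → α) (z : κ → α), Function.extend τ (x ∘ τ) (Function.extend τ z x) = x := by
    intro x z
    funext i
    by_cases h : ∃ j, τ j = i
    · obtain ⟨j, rfl⟩ := h
      rw [hτ.extend_apply]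
      rfl
    · rw [Function.extend_apply' _ _ _ h, Function.extend_apply' _ _ _ h]
  have hc : ∀ (x : ι → α) (z : κ → α), (Function.extend τ z x) ∘ τ = z := by
    intro x z
    funext j
    exact hτ.extend_apply _ _ _
  rw [← Finset.sum_product']
  have : (∏ j, ((U (τ j)).card : ℝ)) * ∑ x ∈ Fintype.piFinset U, g x =
      ∑ p ∈ Fintype.piFinset U ×ˢ Fintype.piFinset (fun j => U (τ j)), g p.1 := by
    rw [Finset.sum_product]
    simp only [Finset.sum_const, Fintype.card_piFinset, nsmul_eq_mul]
    rw [Finset.mul_sum]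
    push_cast
    rfl
  rw [this]
  refine Finset.sum_nbij' (fun p => (Function.extend τ p.2 p.1, p.1 ∘ τ))
    (fun p => (Function.extend τ p.2 p.1, p.1 ∘ τ)) ?_ ?_ ?_ ?_ ?_
  · rintro ⟨x, z⟩ h
    rw [Finset.mem_product] at *
    exact ⟨hext x h.1 z h.2, hcomp x h.1⟩
  · rintro ⟨x, z⟩ h
    rw [Finset.mem_product] at *
    exact ⟨hext x h.1 z h.2, hcomp x h.1⟩
  · rintro ⟨x, z⟩ h
    simp only [hinv, hc]
  · rintro ⟨x, z⟩ h
    simp only [hinv, hc]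
  · rintro ⟨x, z⟩ h
    rfl

/-- Single coordinate resampling. -/
theorem resample_one {ι α : Type*} [Fintype ι] [DecidableEq ι]
    (U : ι → Finset α) (p : ι) (g : (ι → α) → ℝ) :
    ∑ x ∈ Fintype.piFinset U, ∑ y ∈ U p, g (Function.update x p y)
      = ((U p).card : ℝ) * ∑ x ∈ Fintype.piFinset U, g x := by
  have h := resample U (fun _ : Unit => p) (fun _ _ _ => rfl) g
  simp only [Finset.univ_unique, Finset.prod_const, Finset.card_singleton, pow_one] at h
  rw [← h]
  refine Finset.sum_congr rfl fun x _ => ?_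
  refine Finset.sum_nbij' (fun y => fun _ => y) (fun z => z ()) ?_ ?_ ?_ ?_ ?_
  · intro y hy
    rw [Fintype.mem_piFinset]
    exact fun _ => hy
  · intro z hz
    rw [Fintype.mem_piFinset] at hz
    exact hz ()
  · intro y _; rfl
  · intro z _; rfl
  · intro y hy
    congr 1
    funext i
    by_cases hi : i = p
    · subst hi
      rw [Function.update_self]
      have : Function.Injective (fun _ : Unit => i) := fun _ _ _ => rfl
      exact (this.extend_apply (fun _ => y) x ()).symm
    · rw [Function.update_of_ne hi, Function.extend_apply']
      rintro ⟨_, h⟩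
      exact hi h.symm

theorem image_strictMono_inj {r : ℕ} {α : Type*} [LinearOrder α] {v w : Fin r → α}
    (hv : StrictMono v) (hw : StrictMono w)
    (h : Finset.univ.image v = Finset.univ.image w) : v = w := by
  have hc : (Finset.univ.image v).card = r := by
    rw [Finset.card_image_of_injective _ hv.injective]; simp
  have h1 := Finset.orderEmbOfFin_unique hc (f := v) (fun x => by simp) hv
  have h2 := Finset.orderEmbOfFin_unique hc (f := w) (fun x => by rw [h]; simp) hw
  rw [h1, h2]

open Classical in
theorem card_strictMono {r : ℕ} {α : Type*} [LinearOrder α] (S : Finset α) (P : Finset α → Prop) :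
    ((Fintype.piFinset (fun _ : Fin r => S)).filter
      (fun w => StrictMono w ∧ P (Finset.univ.image w))).card
      = ((Finset.powersetCard r S).filter P).card := by
  refine Finset.card_nbij (fun w => Finset.univ.image w) ?_ ?_ ?_
  · intro w hw
    simp only [Finset.coe_filter, Set.mem_setOf_eq, Finset.mem_filter, Fintype.mem_piFinset, Finset.mem_powersetCard] at *
    refine ⟨⟨?_, ?_⟩, hw.2.2⟩
    · intro x hx
      obtain ⟨i, _, rfl⟩ := Finset.mem_image.1 hx
      exact hw.1 i
    · rw [Finset.card_image_of_injective _ hw.2.1.injective]; simp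
  · intro v hv w hw h
    simp only [Finset.coe_filter, Set.mem_setOf_eq] at hv hw
    exact image_strictMono_inj hv.2.1 hw.2.1 h
  · intro e he
    simp only [Finset.coe_filter, Set.mem_setOf_eq, Finset.mem_powersetCard] at he
    have him : Finset.univ.image (e.orderEmbOfFin he.1.2) = e := by
      ext x
      have := Finset.range_orderEmbOfFin e he.1.2
      rw [← Finset.mem_coe (s := e), ← this]
      simp
    refine ⟨e.orderEmbOfFin he.1.2, ?_, him⟩
    simp only [Finset.coe_filter, Set.mem_setOf_eq, Fintype.mem_piFinset]
    refine ⟨fun i => he.1.1 (Finset.orderEmbOfFin_mem e he.1.2 i),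
      (e.orderEmbOfFin he.1.2).strictMono, ?_⟩
    rw [him]; exact he.2

open Classical in
theorem card_strictMono' {r : ℕ} {α : Type*} [LinearOrder α] (S : Finset α) :
    ((Fintype.piFinset (fun _ : Fin r => S)).filter
      (fun w => StrictMono w)).card = S.card.choose r := by
  have := card_strictMono (r := r) S (fun _ => True)
  simpa using this

theorem pow_le_choose_mul (n r : ℕ) (h : r ≤ n) : n ^ r ≤ n.choose r * r ^ r := by
  induction r generalizing n with
  | zero => simp
  | succ r ih =>
    rcases n with _ | n
    · omega
    have h1 := Nat.add_one_mul_choose_eq n r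
    have h2 := ih n (by omega)
    -- (n+1) * choose n r = choose (n+1) (r+1) * (r+1)
    rcases Nat.eq_zero_or_pos r with hr | hr
    · subst hr; simp
    have h3 : ((n + 1) * r) ^ r ≤ (n * (r + 1)) ^ r := by
      apply Nat.pow_le_pow_left
      nlinarith
    rw [mul_pow, mul_pow] at h3
    have h4 : (n + 1) ^ r * r ^ r ≤ n.choose r * (r + 1) ^ r * r ^ r := by
      calc (n + 1) ^ r * r ^ r ≤ n ^ r * (r + 1) ^ r := h3
        _ ≤ (n.choose r * r ^ r) * (r + 1) ^ r := Nat.mul_le_mul_right _ h2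
        _ = _ := by ring
    have h5 : (n + 1) ^ r ≤ n.choose r * (r + 1) ^ r :=
      Nat.le_of_mul_le_mul_right h4 (by positivity)
    calc (n + 1) ^ (r + 1) = (n + 1) * (n + 1) ^ r := by ring
      _ ≤ (n + 1) * (n.choose r * (r + 1) ^ r) := Nat.mul_le_mul_left _ h5
      _ = ((n + 1) * n.choose r) * (r + 1) ^ r := by ring
      _ = _ := by rw [h1]; ring

open Classical in
theorem fixcount {K m n : ℕ} (κ : Fin m → Fin K) (hκ : Function.Injective κ) (τ : Fin m → Fin n) :
    (Finset.univ.filter (fun Q : Fin K → Fin n => Q ∘ κ = τ)).card * n ^ m = n ^ K := by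
  have h := resample (fun _ : Fin K => (Finset.univ : Finset (Fin n))) κ hκ
    (fun Q => if Q ∘ κ = τ then 1 else 0)
  have hc : ∀ (x : Fin K → Fin n) (z : Fin m → Fin n), (Function.extend κ z x) ∘ κ = z := by
    intro x z
    funext j
    exact hκ.extend_apply _ _ _
  simp only [hc, Fintype.piFinset_univ] at h
  simp at h
  have h' : ((n : ℝ) ^ K) = n ^ m * ((Finset.univ.filter (fun Q : Fin K → Fin n => Q ∘ κ = τ)).card : ℝ) := h
  have : (((Finset.univ.filter (fun Q : Fin K → Fin n => Q ∘ κ = τ)).card * n ^ m : ℕ) : ℝ) = ((n ^ K : ℕ) : ℝ) := by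
    push_cast
    rw [h']; ring
  exact_mod_cast this

def MonoOn {m n : ℕ} {α : Type*} [Preorder α] (f : Fin n → α) (τ : Fin m → Fin n) : Prop :=
  StrictMono (f ∘ τ) ∨ StrictAnti (f ∘ τ)

theorem ramsey_mono (m : ℕ) : ∃ K : ℕ, m ≤ K ∧ ∀ f : Fin K → ℕ, Function.Injective f →
    ∃ κ : Fin m → Fin K, StrictMono κ ∧ MonoOn f κ := by
  obtain ⟨K, hK⟩ := ramsey 2 m m
  have main : ∀ f : Fin K → ℕ, Function.Injective f →
    ∃ κ : Fin m → Fin K, StrictMono κ ∧ MonoOn f κ := by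
    intro f hf
    have key : ∀ A ⊆ Finset.range K, A.card = m → ∃ κ : Fin m → Fin K, StrictMono κ ∧
        ∀ i, (κ i : ℕ) ∈ A := by
      intro A hA hc
      refine ⟨fun i => ⟨A.orderEmbOfFin hc i, ?_⟩, ?_, ?_⟩
      · exact Finset.mem_range.1 (hA (Finset.orderEmbOfFin_mem A hc i))
      · intro i j hij
        exact (A.orderEmbOfFin hc).strictMono hij
      · intro i
        exact Finset.orderEmbOfFin_mem A hc i
    rcases hK (Finset.range K) (by simp) (fun B => ∀ i j : Fin K, (i : ℕ) ∈ B → (j : ℕ) ∈ B → i < j → f i < f j)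
      with ⟨A, hA, hc, hcol⟩ | ⟨A, hA, hc, hcol⟩
    · obtain ⟨κ, hκ, hm⟩ := key A hA hc
      refine ⟨κ, hκ, Or.inl ?_⟩
      intro i j hij
      refine hcol {(κ i : ℕ), (κ j : ℕ)} ?_ ?_ (κ i) (κ j) (by simp) (by simp) (hκ hij)
      · intro x hx
        simp at hx
        rcases hx with rfl | rfl
        · exact hm i
        · exact hm j
      · apply Finset.card_pair
        intro h
        exact absurd (Fin.ext h) (hκ hij).ne
    · obtain ⟨κ, hκ, hm⟩ := key A hA hc
      refine ⟨κ, hκ, Or.inr ?_⟩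
      intro i j hij
      have := hcol {(κ i : ℕ), (κ j : ℕ)} (by
        intro x hx
        simp at hx
        rcases hx with rfl | rfl
        · exact hm i
        · exact hm j) (by
        apply Finset.card_pair
        intro h
        exact absurd (Fin.ext h) (hκ hij).ne)
      push Not at this
      obtain ⟨a, b, ha, hb, hab, hf'⟩ := this
      simp only [Finset.mem_insert, Finset.mem_singleton, Fin.val_inj] at ha hb
      have hlt := hκ hij
      rcases ha with rfl | rfl <;> rcases hb with rfl | rfl
      · exact absurd hab (lt_irrefl _)
      · exact lt_of_le_of_ne hf' (fun h => hlt.ne' (hf h))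
      · exact absurd hab hlt.not_gt
      · exact absurd hab (lt_irrefl _)
  refine ⟨K, ?_, main⟩
  obtain ⟨κ, hκ, -⟩ := main (fun i => i) Fin.val_injective
  simpa using Fintype.card_le_of_injective κ hκ.injective

open Classical in
theorem mono_count (m : ℕ) (hm : 1 ≤ m) : ∃ C K : ℕ, 0 < C ∧ ∀ n, K ≤ n → ∀ f : Fin n → Fin n, Function.Injective f →
    n ^ m ≤ C * (Finset.univ.filter (fun τ : Fin m → Fin n => StrictMono τ ∧ MonoOn f τ)).card := by
  obtain ⟨K, hmK, hK⟩ := ramsey_mono m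
  refine ⟨K ^ K * K ^ m, K, by have : 0 < K := by omega
                               positivity, fun n hn f hf => ?_⟩
  have hn0 : 0 < n := by omega
  set M := Finset.univ.filter (fun τ : Fin m → Fin n => StrictMono τ ∧ MonoOn f τ) with hM
  have h1 : (Finset.univ.filter (fun Q : Fin K → Fin n => StrictMono Q)).card = n.choose K := by
    have := card_strictMono' (r := K) (Finset.univ : Finset (Fin n))
    simpa using this
  have hsub : (Finset.univ.filter (fun Q : Fin K → Fin n => StrictMono Q)) ⊆
      ((Finset.univ.filter (fun κ : Fin m → Fin K => StrictMono κ)) ×ˢ M).biUnion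
        (fun p => Finset.univ.filter (fun Q : Fin K → Fin n => Q ∘ p.1 = p.2)) := by
    intro Q hQ
    simp only [Finset.mem_filter, Finset.mem_univ, true_and] at hQ
    obtain ⟨κ, hκ, hmono⟩ := hK (fun i => (f (Q i) : ℕ)) (by
      intro a b h
      exact hQ.injective (hf (Fin.ext h)))
    rw [Finset.mem_biUnion]
    refine ⟨(κ, Q ∘ κ), ?_, by simp⟩
    simp only [Finset.mem_product, Finset.mem_filter, Finset.mem_univ, true_and, hM]
    exact ⟨hκ, hQ.comp hκ, hmono⟩
  have h2 : n.choose K * n ^ m ≤ (K ^ m * M.card) * n ^ K := by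
    rw [← h1]
    calc _ ≤ (∑ p ∈ ((Finset.univ.filter (fun κ : Fin m → Fin K => StrictMono κ)) ×ˢ M),
          (Finset.univ.filter (fun Q : Fin K → Fin n => Q ∘ p.1 = p.2)).card) * n ^ m :=
          Nat.mul_le_mul_right _ ((Finset.card_le_card hsub).trans Finset.card_biUnion_le)
      _ = ∑ p ∈ ((Finset.univ.filter (fun κ : Fin m → Fin K => StrictMono κ)) ×ˢ M), n ^ K := by
          rw [Finset.sum_mul]
          refine Finset.sum_congr rfl fun p hp => ?_
          simp only [Finset.mem_product, Finset.mem_filter, Finset.mem_univ, true_and] at hp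
          exact fixcount p.1 hp.1.injective p.2
      _ ≤ _ := by
          rw [Finset.sum_const, smul_eq_mul, Finset.card_product]
          gcongr
          refine (Finset.card_filter_le _ _).trans ?_
          simp
  have h3 := pow_le_choose_mul n K hn
  have h4 : n ^ K * n ^ m ≤ n ^ K * (K ^ K * K ^ m * M.card) := by
    calc n ^ K * n ^ m ≤ (n.choose K * K ^ K) * n ^ m := Nat.mul_le_mul_right _ h3
      _ = K ^ K * (n.choose K * n ^ m) := by ring
      _ ≤ K ^ K * ((K ^ m * M.card) * n ^ K) := Nat.mul_le_mul_left _ h2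
      _ = _ := by ring
  exact Nat.le_of_mul_le_mul_left h4 (by positivity)

def Share2 {m n : ℕ} (τ τ' : Fin m → Fin n) : Prop :=
  ∃ i i' j j', i ≠ i' ∧ τ i = τ' j ∧ τ i' = τ' j'

open Classical in
theorem share_count {m n : ℕ} (τ' : Fin m → Fin n) :
    (Finset.univ.filter (fun τ : Fin m → Fin n => Share2 τ τ')).card * n ^ 2 ≤ m ^ 4 * n ^ m := by
  have hsub : (Finset.univ.filter (fun τ : Fin m → Fin n => Share2 τ τ')) ⊆
      ((Finset.univ : Finset ((Fin m × Fin m) × (Fin m × Fin m))).filter (fun p => p.1.1 ≠ p.1.2)).biUnion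
        (fun p => Finset.univ.filter (fun τ : Fin m → Fin n => τ ∘ ![p.1.1, p.1.2] = ![τ' p.2.1, τ' p.2.2])) := by
    intro τ hτ
    simp only [Finset.mem_filter, Finset.mem_univ, true_and] at hτ
    obtain ⟨i, i', j, j', hne, h1, h2⟩ := hτ
    rw [Finset.mem_biUnion]
    refine ⟨((i, i'), (j, j')), by simpa using hne, ?_⟩
    simp only [Finset.mem_filter, Finset.mem_univ, true_and]
    funext x
    fin_cases x
    · exact h1
    · exact h2
  calc _ ≤ (∑ p ∈ ((Finset.univ : Finset ((Fin m × Fin m) × (Fin m × Fin m))).filter (fun p => p.1.1 ≠ p.1.2)),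
          (Finset.univ.filter (fun τ : Fin m → Fin n => τ ∘ ![p.1.1, p.1.2] = ![τ' p.2.1, τ' p.2.2])).card) * n ^ 2 :=
          Nat.mul_le_mul_right _ ((Finset.card_le_card hsub).trans Finset.card_biUnion_le)
      _ = ∑ p ∈ ((Finset.univ : Finset ((Fin m × Fin m) × (Fin m × Fin m))).filter (fun p => p.1.1 ≠ p.1.2)), n ^ m := by
          rw [Finset.sum_mul]
          refine Finset.sum_congr rfl fun p hp => ?_
          simp only [Finset.mem_filter, Finset.mem_univ, true_and] at hp
          refine fixcount ![p.1.1, p.1.2] ?_ _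
          intro a b hab
          fin_cases a <;> fin_cases b <;> simp_all
      _ ≤ _ := by
          rw [Finset.sum_const, smul_eq_mul]
          gcongr
          refine (Finset.card_filter_le _ _).trans ?_
          simp
          apply le_of_eq; ring

open Classical in
theorem greedy_step {m n C : ℕ} (hn : 0 < n) (hC : 0 < C)
    (R : Finset (Fin n → Fin n)) (hR : R.Nonempty)
    (hmono : ∀ f ∈ R, n ^ m ≤ C * (Finset.univ.filter (fun τ : Fin m → Fin n => StrictMono τ ∧ MonoOn f τ)).card)
    (𝓖 : Finset (Fin m → Fin n)) (h𝓖 : 𝓖.card * (m ^ 4 * (2 * C)) ≤ n ^ 2) :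
    ∃ τ : Fin m → Fin n, StrictMono τ ∧ (∀ τ' ∈ 𝓖, ¬ Share2 τ τ') ∧
      R.card ≤ 2 * C * (R.filter (fun f => MonoOn f τ)).card := by
  by_contra hcon
  push Not at hcon
  set Al := Finset.univ.filter (fun τ : Fin m → Fin n => StrictMono τ ∧ ∀ τ' ∈ 𝓖, ¬ Share2 τ τ') with hAl
  set bad := Finset.univ.filter (fun τ : Fin m → Fin n => ∃ τ' ∈ 𝓖, Share2 τ τ') with hbad
  have hbadc : bad.card * (2 * C) ≤ n ^ m := by
    have h1 : bad.card * n ^ 2 ≤ 𝓖.card * (m ^ 4 * n ^ m) := by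
      have hsub : bad ⊆ 𝓖.biUnion (fun τ' => Finset.univ.filter (fun τ : Fin m → Fin n => Share2 τ τ')) := by
        intro τ hτ
        simp only [hbad, Finset.mem_filter, Finset.mem_univ, true_and] at hτ
        simpa using hτ
      calc _ ≤ (∑ τ' ∈ 𝓖, (Finset.univ.filter (fun τ : Fin m → Fin n => Share2 τ τ')).card) * n ^ 2 :=
            Nat.mul_le_mul_right _ ((Finset.card_le_card hsub).trans Finset.card_biUnion_le)
        _ ≤ ∑ τ' ∈ 𝓖, m ^ 4 * n ^ m := by
            rw [Finset.sum_mul]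
            exact Finset.sum_le_sum fun τ' _ => share_count τ'
        _ = _ := by simp
    have h2 : n ^ 2 * (bad.card * (2 * C)) ≤ n ^ 2 * n ^ m := by
      calc n ^ 2 * (bad.card * (2 * C)) = (bad.card * n ^ 2) * (2 * C) := by ring
        _ ≤ (𝓖.card * (m ^ 4 * n ^ m)) * (2 * C) := Nat.mul_le_mul_right _ h1
        _ = (𝓖.card * (m ^ 4 * (2 * C))) * n ^ m := by ring
        _ ≤ n ^ 2 * n ^ m := Nat.mul_le_mul_right _ h𝓖
    exact Nat.le_of_mul_le_mul_left h2 (by positivity)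
  have hper : ∀ f ∈ R, n ^ m ≤ 2 * C * (Al.filter (fun τ => MonoOn f τ)).card := by
    intro f hf
    have h1 := hmono f hf
    have h2 : (Finset.univ.filter (fun τ : Fin m → Fin n => StrictMono τ ∧ MonoOn f τ)).card
        ≤ (Al.filter (fun τ => MonoOn f τ)).card + bad.card := by
      refine (Finset.card_le_card ?_).trans (Finset.card_union_le _ _)
      intro τ hτ
      simp only [Finset.mem_filter, Finset.mem_univ, true_and, Finset.mem_union, hAl, hbad] at *
      by_cases h : ∃ τ' ∈ 𝓖, Share2 τ τ'
      · exact Or.inr h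
      · push Not at h
        exact Or.inl ⟨⟨hτ.1, h⟩, hτ.2⟩
    have h3 := Nat.mul_le_mul_left (2 * C) h2
    nlinarith
  have hsum : ∑ f ∈ R, (Al.filter (fun τ => MonoOn f τ)).card
      = ∑ τ ∈ Al, (R.filter (fun f => MonoOn f τ)).card := by
    have := Finset.sum_card_bipartiteAbove_eq_sum_card_bipartiteBelow (s := R) (t := Al) (fun f τ => MonoOn f τ)
    exact this
  have hge : R.card * n ^ m ≤ 2 * C * ∑ τ ∈ Al, (R.filter (fun f => MonoOn f τ)).card := by
    rw [← hsum, Finset.mul_sum]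
    calc R.card * n ^ m = ∑ f ∈ R, n ^ m := by simp
      _ ≤ _ := Finset.sum_le_sum hper
  have hAlc : Al.card ≤ n ^ m := by
    refine (Finset.card_filter_le _ _).trans ?_
    simp
  have hAlne : Al.Nonempty := by
    by_contra h
    rw [Finset.not_nonempty_iff_eq_empty] at h
    rw [h] at hge
    simp at hge
    have : 0 < n ^ m := by positivity
    rcases hge with h | h
    · exact hR.ne_empty h
    · omega
  have hlt : 2 * C * ∑ τ ∈ Al, (R.filter (fun f => MonoOn f τ)).card < R.card * n ^ m := by
    rw [Finset.mul_sum]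
    calc _ < ∑ τ ∈ Al, R.card := by
            refine Finset.sum_lt_sum_of_nonempty hAlne fun τ hτ => ?_
            simp only [hAl, Finset.mem_filter, Finset.mem_univ, true_and] at hτ
            exact hcon τ hτ.1 hτ.2
      _ = Al.card * R.card := by simp
      _ ≤ n ^ m * R.card := Nat.mul_le_mul_right _ hAlc
      _ = _ := by ring
  omega

open Classical in
theorem greedy {m n C : ℕ} (hn : 0 < n) (hC : 0 < C)
    (R : Finset (Fin n → Fin n))
    (hmono : ∀ f ∈ R, n ^ m ≤ C * (Finset.univ.filter (fun τ : Fin m → Fin n => StrictMono τ ∧ MonoOn f τ)).card)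
    (J : ℕ) (hJ : J * (m ^ 4 * (2 * C)) ≤ n ^ 2) :
    ∃ 𝓖 : Finset (Fin m → Fin n), 𝓖.card ≤ J ∧ (∀ τ ∈ 𝓖, StrictMono τ) ∧
      (∀ τ ∈ 𝓖, ∀ τ' ∈ 𝓖, τ ≠ τ' → ¬ Share2 τ τ') ∧
      ((R.filter (fun f => ∀ τ ∈ 𝓖, ¬ MonoOn f τ)).card : ℝ) ≤ (1 - 1 / (2 * C : ℝ)) ^ J * R.card := by
  have hC1 : (1 : ℝ) ≤ C := by exact_mod_cast hC
  have hq : (0 : ℝ) ≤ 1 - 1 / (2 * C : ℝ) := by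
    rw [sub_nonneg, div_le_one (by positivity)]
    linarith
  induction J with
  | zero =>
    refine ⟨∅, by simp, by simp, by simp, ?_⟩
    simp
  | succ J ih =>
    obtain ⟨𝓖, hc, hs, hl, hb⟩ := ih (le_trans (Nat.mul_le_mul_right _ (Nat.le_succ J)) hJ)
    set R' := R.filter (fun f => ∀ τ ∈ 𝓖, ¬ MonoOn f τ) with hR'
    by_cases hne : R'.Nonempty
    · obtain ⟨τ, hτ, hsh, hcard⟩ := greedy_step hn hC R' hne
        (fun f hf => hmono f (Finset.mem_of_mem_filter f hf)) 𝓖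
        (le_trans (Nat.mul_le_mul_right _ (by omega)) hJ)
      refine ⟨insert τ 𝓖, ?_, ?_, ?_, ?_⟩
      · exact (Finset.card_insert_le _ _).trans (by omega)
      · intro σ hσ
        rcases Finset.mem_insert.1 hσ with rfl | h
        · exact hτ
        · exact hs σ h
      · intro σ hσ σ' hσ' hne'
        rcases Finset.mem_insert.1 hσ with rfl | h <;> rcases Finset.mem_insert.1 hσ' with rfl | h'
        · exact absurd rfl hne'
        · exact hsh σ' h'
        · rintro ⟨i, i', j, j', h1, h2, h3⟩
          refine hsh σ h ⟨j, j', i, i', ?_, h2.symm, h3.symm⟩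
          rintro rfl
          exact h1 ((hs σ h).injective (h2.trans h3.symm))
        · exact hl σ h σ' h' hne'
      · have hsplit : (R.filter (fun f => ∀ σ ∈ insert τ 𝓖, ¬ MonoOn f σ)).card
            + (R'.filter (fun f => MonoOn f τ)).card ≤ R'.card := by
          have h0 := Finset.card_filter_add_card_filter_not (s := R') (fun f => MonoOn f τ)
          have h1 : (R.filter (fun f => ∀ σ ∈ insert τ 𝓖, ¬ MonoOn f σ)).card
              ≤ (R'.filter (fun f => ¬ MonoOn f τ)).card := by
            apply Finset.card_le_card
            intro f hf
            simp only [hR', Finset.mem_filter, Finset.mem_insert, forall_eq_or_imp] at *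
            tauto
          omega
        have h1 : ((R.filter (fun f => ∀ σ ∈ insert τ 𝓖, ¬ MonoOn f σ)).card : ℝ)
            + ((R'.filter (fun f => MonoOn f τ)).card : ℝ) ≤ R'.card := by exact_mod_cast hsplit
        have h2 : (R'.card : ℝ) ≤ 2 * C * ((R'.filter (fun f => MonoOn f τ)).card : ℝ) := by
          exact_mod_cast hcard
        have h3 : (R'.card : ℝ) / (2 * C) ≤ ((R'.filter (fun f => MonoOn f τ)).card : ℝ) := by
          rw [div_le_iff₀ (by positivity)]
          linarith
        calc _ ≤ (1 - 1 / (2 * C : ℝ)) * R'.card := by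
              rw [sub_mul, one_mul, one_div_mul_eq_div]
              linarith
          _ ≤ (1 - 1 / (2 * C : ℝ)) * ((1 - 1 / (2 * C : ℝ)) ^ J * R.card) :=
              mul_le_mul_of_nonneg_left hb hq
          _ = _ := by ring
    · refine ⟨𝓖, by omega, hs, hl, ?_⟩
      rw [Finset.not_nonempty_iff_eq_empty] at hne
      rw [← hR', hne]
      simp only [Finset.card_empty, Nat.cast_zero]
      positivity

theorem exists_G (m : ℕ) (hm : 1 ≤ m) : ∃ N : ℕ, ∃ 𝓖 : Finset (Fin m → Fin N),
    (∀ τ ∈ 𝓖, StrictMono τ) ∧ (∀ τ ∈ 𝓖, ∀ τ' ∈ 𝓖, τ ≠ τ' → ¬ Share2 τ τ') ∧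
    ∀ f : Fin N → ℕ, Function.Injective f → ∃ τ ∈ 𝓖, MonoOn f τ := by
  classical
  obtain ⟨C, K, hC, hcount⟩ := mono_count m hm
  set a := m ^ 4 * (2 * C) with ha
  have ha0 : 0 < a := by positivity
  have hC1 : (1 : ℝ) ≤ C := by exact_mod_cast hC
  have hq : (0 : ℝ) ≤ 1 - 1 / (2 * C : ℝ) := by
    rw [sub_nonneg, div_le_one (by positivity)]
    linarith
  have hq1 : 1 - 1 / (2 * C : ℝ) < 1 := by
    have : 0 < 1 / (2 * C : ℝ) := by positivity
    linarith
  have ht := tendsto_self_mul_const_pow_of_lt_one hq hq1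
  have hev := (ht.eventually (gt_mem_nhds (show (0 : ℝ) < 1 / a by positivity))).and
    (Filter.eventually_ge_atTop (K + 1))
  obtain ⟨l, hl, hlK⟩ := hev.exists
  set n := a * l with hn
  have hnK : K ≤ n := by nlinarith
  have hn0 : 0 < n := by
    have : 0 < l := by omega
    positivity
  set R := Finset.univ.filter (fun f : Fin n → Fin n => Function.Injective f) with hR
  obtain ⟨𝓖, -, hs, hlin, hb⟩ := greedy (m := m) hn0 hC R (fun f hf => hcount n hnK f (by simpa [hR] using hf))
    (n * l) (by rw [← ha, hn]; apply le_of_eq; ring)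
  refine ⟨n, 𝓖, hs, hlin, fun f hf => ?_⟩
  have hRc : (R.card : ℝ) ≤ (n : ℝ) ^ n := by
    have : R.card ≤ n ^ n := (Finset.card_filter_le _ _).trans (by simp)
    exact_mod_cast this
  have hlt : ((R.filter (fun f => ∀ τ ∈ 𝓖, ¬ MonoOn f τ)).card : ℝ) < 1 := by
    refine hb.trans_lt ?_
    calc _ ≤ (1 - 1 / (2 * C : ℝ)) ^ (n * l) * (n : ℝ) ^ n :=
          mul_le_mul_of_nonneg_left hRc (by positivity)
      _ = ((n : ℝ) * (1 - 1 / (2 * C : ℝ)) ^ l) ^ n := by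
          rw [mul_pow, ← pow_mul, mul_comm l n, mul_comm]
      _ < 1 := by
          apply pow_lt_one₀ (by positivity) _ hn0.ne'
          rw [hn]; push_cast
          rw [lt_div_iff₀ (by positivity)] at hl
          calc _ = (l : ℝ) * (1 - 1 / (2 * C : ℝ)) ^ l * a := by ring
            _ < 1 := hl
  have hempty : R.filter (fun f => ∀ τ ∈ 𝓖, ¬ MonoOn f τ) = ∅ := by
    rw [← Finset.card_eq_zero]
    have : (R.filter (fun f => ∀ τ ∈ 𝓖, ¬ MonoOn f τ)).card < 1 := by exact_mod_cast hlt
    omega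
  -- rank function
  have hrank : ∀ i, (Finset.univ.filter (fun j => f j < f i)).card < n := by
    intro i
    have : (Finset.univ.filter (fun j => f j < f i)) ⊂ Finset.univ := by
      refine Finset.ssubset_univ_iff.2 ?_
      intro h
      have := Finset.mem_univ i
      rw [← h] at this
      simp at this
    simpa using Finset.card_lt_card this
  set g : Fin n → Fin n := fun i => ⟨_, hrank i⟩ with hg
  have hfg : ∀ i j, f i < f j → g i < g j := by
    intro i j hij
    rw [hg, Fin.mk_lt_mk]
    apply Finset.card_lt_card
    rw [Finset.ssubset_iff_of_subset]
    · exact ⟨i, by simpa using hij, by simp⟩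
    · intro x hx
      simp only [Finset.mem_filter, Finset.mem_univ, true_and] at *
      exact hx.trans hij
  have hgf : ∀ i j, g i < g j → f i < f j := by
    intro i j hij
    by_contra h
    rcases (not_lt.1 h).lt_or_eq with h' | h'
    · exact absurd (hfg _ _ h') hij.not_gt
    · rw [hf h'] at hij
      exact lt_irrefl _ hij
  have hginj : Function.Injective g := by
    intro i j hij
    by_contra hne
    rcases lt_or_gt_of_ne (fun h => hne (hf h)) with h | h
    · exact (hfg _ _ h).ne hij
    · exact (hfg _ _ h).ne' hij
  have hmem : g ∉ R.filter (fun f => ∀ τ ∈ 𝓖, ¬ MonoOn f τ) := by rw [hempty]; simp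
  simp only [hR, Finset.mem_filter, Finset.mem_univ, true_and, hginj] at hmem
  push Not at hmem
  obtain ⟨τ, hτ, hm'⟩ := hmem
  refine ⟨τ, hτ, ?_⟩
  rcases hm' with h | h
  · exact Or.inl fun i j hij => hgf _ _ (h hij)
  · exact Or.inr fun i j hij => hgf _ _ (h hij)

open Classical in
noncomputable def cnt {ι : Type*} [Fintype ι] [DecidableEq ι] (T : (ι → ℕ) → Prop) (S : ι → Finset ℕ) : ℕ :=
  ((Fintype.piFinset S).filter T).card

theorem cnt_mono {ι : Type*} [Fintype ι] [DecidableEq ι] (T : (ι → ℕ) → Prop) {S S' : ι → Finset ℕ}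
    (h : ∀ i, S' i ⊆ S i) : cnt T S' ≤ cnt T S := by
  classical
  exact Finset.card_le_card (Finset.filter_subset_filter _ (Fintype.piFinset_subset _ _ h))

theorem shrink {m : ℕ} (T : (Fin m → ℕ) → Prop) (a : ℕ) (c : ℝ) (hc : 0 ≤ c) :
    ∀ k : ℕ, ∀ S : Fin m → Finset ℕ, ∑ i, (S i).card = k → (∀ i, a ≤ (S i).card) →
      (cnt T S : ℝ) ≤ c * ∏ i, ((S i).card : ℝ) →
      ∃ S' : Fin m → Finset ℕ, (∀ i, S' i ⊆ S i) ∧ (∀ i, (S' i).card = a) ∧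
        (cnt T S' : ℝ) ≤ c * (a : ℝ) ^ m := by
  classical
  intro k
  induction k with
  | zero =>
    intro S hk ha hcnt
    have h0 : ∀ i, (S i).card = 0 := by
      intro i
      have := Finset.single_le_sum (f := fun i => (S i).card) (fun i _ => Nat.zero_le _) (Finset.mem_univ i)
      simp only [hk] at this
      omega
    refine ⟨S, fun i => Finset.Subset.refl _, fun i => ?_, ?_⟩
    · have := ha i; have := h0 i; omega
    · refine hcnt.trans (le_of_eq ?_)
      congr 1
      rw [Finset.prod_congr rfl (g := fun _ => (a : ℝ))]
      · simp
      · intro i _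
        have h1 := ha i
        have h2 := h0 i
        have : a = 0 := by omega
        rw [h2, this]
  | succ k ih =>
    intro S hk ha hcnt
    by_cases hall : ∀ i, (S i).card = a
    · refine ⟨S, fun i => Finset.Subset.refl _, hall, ?_⟩
      refine hcnt.trans (le_of_eq ?_)
      simp [hall]
    · push Not at hall
      obtain ⟨p, hp⟩ := hall
      have hap : a < (S p).card := lt_of_le_of_ne (ha p) hp.symm
      set N : ℕ → ℕ := fun x => (((Fintype.piFinset S).filter T).filter (fun w => w p = x)).card with hN
      have hsum : cnt T S = ∑ x ∈ S p, N x := by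
        have hmaps : Set.MapsTo (fun w : Fin m → ℕ => w p) ((Fintype.piFinset S).filter T : Finset (Fin m → ℕ)) (S p : Set ℕ) := by
          intro w hw
          have hw' := (Finset.mem_filter.1 (Finset.mem_coe.1 hw)).1
          exact Finset.mem_coe.2 (Fintype.mem_piFinset.1 hw' p)
        have := Finset.card_eq_sum_card_fiberwise hmaps
        simpa only [cnt, hN] using this
      obtain ⟨x, hx, hNx⟩ : ∃ x ∈ S p, cnt T S ≤ (S p).card * N x := by
        by_contra hcon
        push Not at hcon
        have hne : (S p).Nonempty := by rw [← Finset.card_pos]; omega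
        have h1 : ∑ x ∈ S p, (S p).card * N x < ∑ x ∈ S p, cnt T S :=
          Finset.sum_lt_sum_of_nonempty hne hcon
        rw [← Finset.mul_sum, ← hsum] at h1
        simp at h1
      set S1 : Fin m → Finset ℕ := Function.update S p ((S p).erase x) with hS1
      have hS1p : S1 p = (S p).erase x := by simp [hS1]
      have hS1ne : ∀ i, i ≠ p → S1 i = S i := fun i hi => by simp [hS1, hi]
      have hsub : ∀ i, S1 i ⊆ S i := by
        intro i
        by_cases hi : i = p
        · subst hi; rw [hS1p]; exact Finset.erase_subset _ _
        · rw [hS1ne i hi]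
      have hcp : (S1 p).card + 1 = (S p).card := by
        rw [hS1p]; exact Finset.card_erase_add_one hx
      have hcnt1 : cnt T S1 + N x ≤ cnt T S := by
        rw [cnt, cnt, hN, ← Finset.card_union_of_disjoint]
        · apply Finset.card_le_card
          apply Finset.union_subset
          · exact Finset.filter_subset_filter _ (Fintype.piFinset_subset _ _ hsub)
          · exact Finset.filter_subset _ _
        · rw [Finset.disjoint_left]
          intro w hw hw'
          have h1 := Fintype.mem_piFinset.1 (Finset.mem_filter.1 hw).1 p
          have h2 := (Finset.mem_filter.1 hw').2
          rw [hS1p, h2] at h1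
          simp at h1
      have hsum1 : ∑ i, (S1 i).card = k := by
        rw [← Finset.add_sum_erase _ _ (Finset.mem_univ p)] at hk ⊢
        have : ∑ i ∈ Finset.univ.erase p, (S1 i).card = ∑ i ∈ Finset.univ.erase p, (S i).card :=
          Finset.sum_congr rfl fun i hi => by rw [hS1ne i (Finset.ne_of_mem_erase hi)]
        rw [this]
        omega
      have ha1 : ∀ i, a ≤ (S1 i).card := by
        intro i
        by_cases hi : i = p
        · subst hi; omega
        · rw [hS1ne i hi]; exact ha i
      have hb : (cnt T S1 : ℝ) ≤ c * ∏ i, ((S1 i).card : ℝ) := by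
        rw [← Finset.mul_prod_erase _ _ (Finset.mem_univ p)] at hcnt ⊢
        have : ∏ i ∈ Finset.univ.erase p, ((S1 i).card : ℝ) = ∏ i ∈ Finset.univ.erase p, ((S i).card : ℝ) :=
          Finset.prod_congr rfl fun i hi => by rw [hS1ne i (Finset.ne_of_mem_erase hi)]
        rw [this]
        set Q0 := ∏ i ∈ Finset.univ.erase p, ((S i).card : ℝ)
        have hP : ((S p).card : ℝ) = (S1 p).card + 1 := by exact_mod_cast hcp.symm
        have h1 : (cnt T S1 : ℝ) + N x ≤ cnt T S := by exact_mod_cast hcnt1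
        have h2 : (cnt T S : ℝ) ≤ (S p).card * N x := by exact_mod_cast hNx
        have hpos : (0 : ℝ) < (S p).card := by exact_mod_cast (by omega : 0 < (S p).card)
        have h3 : ((S p).card : ℝ) * cnt T S1 ≤ (S p).card * (c * ((S1 p).card * Q0)) := by
          have e1 : ((S p).card : ℝ) * cnt T S1 ≤ (S1 p).card * cnt T S := by
            have : ((S p).card : ℝ) * (cnt T S1 + N x) ≤ (S p).card * cnt T S :=
              mul_le_mul_of_nonneg_left h1 hpos.le
            rw [hP] at this h2 ⊢
            nlinarith
          have e2 : ((S1 p).card : ℝ) * cnt T S ≤ (S1 p).card * (c * ((S p).card * Q0)) :=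
            mul_le_mul_of_nonneg_left hcnt (by positivity)
          calc _ ≤ _ := e1.trans e2
            _ = _ := by ring
        exact le_of_mul_le_mul_left h3 hpos
      obtain ⟨S', h1, h2, h3⟩ := ih S1 hsum1 ha1 hb
      exact ⟨S', fun i => (h1 i).trans (hsub i), h2, h3⟩

def Robust {m : ℕ} (T : (Fin m → ℕ) → Prop) (U : Fin m → Finset ℕ) (δ c : ℝ) : Prop :=
  ∀ S : Fin m → Finset ℕ, (∀ i, S i ⊆ U i) → (∀ i, δ * (U i).card ≤ (S i).card) →
    c * ∏ i, ((S i).card : ℝ) ≤ cnt T S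

theorem robust_exists {m : ℕ} (θ : ℝ → ℝ) (hθ : ∀ c, 0 < c → 0 < θ c) (hθ1 : ∀ c, 0 < c → c ≤ 1 → θ c ≤ 1)
    (c' : ℝ) (hc' : 0 < c') (hc'1 : c' ≤ 1) :
    ∀ p : ℕ, ∃ ξ : ℝ, 0 < ξ ∧ ξ ≤ 1 ∧ ∀ T : (Fin m → ℕ) → Prop,
      ∀ 𝓤 : Finset (Fin m → ℕ), 𝓤.card = p → (∀ t ∈ 𝓤, Function.Injective t) →
      ∀ (V : ℕ → Finset ℕ) (s : ℕ), (∀ i, (V i).card = s) →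
      ∃ (V' : ℕ → Finset ℕ) (s' : ℕ) (c : ℝ) (𝓑 : Finset (Fin m → ℕ)),
        (∀ i, V' i ⊆ V i) ∧ (∀ i, (V' i).card = s') ∧ ξ * s ≤ s' ∧ 0 < c ∧ c ≤ 1 ∧
        (∀ t ∈ 𝓤, t ∈ 𝓑 → (cnt T (fun i => V' (t i)) : ℝ) ≤ c' * (s' : ℝ) ^ m) ∧
        (∀ t ∈ 𝓤, t ∉ 𝓑 → Robust T (fun i => V' (t i)) (θ c) c) := by
  classical
  intro p
  induction p with
  | zero =>
    refine ⟨1, one_pos, le_refl _, fun T 𝓤 h𝓤 _ V s hV => ⟨V, s, 1, ∅, fun i => Finset.Subset.refl _, hV,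
      by simp, one_pos, le_refl _, ?_, ?_⟩⟩ <;>
    · rw [Finset.card_eq_zero] at h𝓤
      simp [h𝓤]
  | succ p ih =>
    obtain ⟨ξ, hξ, hξ1, H⟩ := ih
    set c := c' * ξ ^ m with hc
    have hc0 : 0 < c := by positivity
    have hc1 : c ≤ 1 := mul_le_one₀ hc'1 (by positivity) (pow_le_one₀ hξ.le hξ1)
    have hδ0 := hθ c hc0
    have hδ1 := hθ1 c hc0 hc1
    set δ := θ c with hδ
    refine ⟨ξ * δ, by positivity, mul_le_one₀ hξ1 hδ0.le hδ1, fun T 𝓤 h𝓤 hinj V s hV => ?_⟩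
    by_cases hall : ∀ t ∈ 𝓤, Robust T (fun i => V (t i)) δ c
    · refine ⟨V, s, c, ∅, fun i => Finset.Subset.refl _, hV, ?_, hc0, hc1, by simp, fun t ht _ => hall t ht⟩
      have : ξ * δ ≤ 1 := mul_le_one₀ hξ1 hδ0.le hδ1
      calc ξ * δ * s ≤ 1 * s := by gcongr
        _ = s := one_mul _
    · push Not at hall
      obtain ⟨t, ht, hbad⟩ := hall
      unfold Robust at hbad
      push Not at hbad
      obtain ⟨S, hSV, hSc, hScnt⟩ := hbad
      simp only [hV] at hSc
      set a := ⌈δ * s⌉₊ with ha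
      have haS : ∀ i, a ≤ (S i).card := fun i => Nat.ceil_le.2 (hSc i)
      have has : a ≤ s := by
        apply Nat.ceil_le.2
        calc δ * s ≤ 1 * s := by gcongr
          _ = s := one_mul _
      obtain ⟨S', hS'S, hS'c, hS'cnt⟩ := shrink T a c hc0.le _ S rfl haS hScnt.le
      have hti := hinj t ht
      choose W hWV hWc using fun i => Finset.exists_subset_card_eq (show a ≤ (V i).card by rw [hV i]; exact has)
      set V2 : ℕ → Finset ℕ := Function.extend t S' W with hV2
      have hV2t : ∀ j, V2 (t j) = S' j := fun j => hti.extend_apply _ _ _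
      have hV2V : ∀ i, V2 i ⊆ V i := by
        intro i
        by_cases h : ∃ j, t j = i
        · obtain ⟨j, rfl⟩ := h
          rw [hV2t]
          exact (hS'S j).trans (hSV j)
        · rw [hV2, Function.extend_apply' _ _ _ h]
          exact hWV i
      have hV2c : ∀ i, (V2 i).card = a := by
        intro i
        by_cases h : ∃ j, t j = i
        · obtain ⟨j, rfl⟩ := h
          rw [hV2t]
          exact hS'c j
        · rw [hV2, Function.extend_apply' _ _ _ h]
          exact hWc i
      obtain ⟨V', s', d, 𝓑, h1, h2, h3, h4, h5, h6, h7⟩ := H T (𝓤.erase t)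
        (by rw [Finset.card_erase_of_mem ht]; omega)
        (fun t' ht' => hinj t' (Finset.mem_of_mem_erase ht')) V2 a hV2c
      refine ⟨V', s', d, insert t 𝓑, fun i => (h1 i).trans (hV2V i), h2, ?_, h4, h5, ?_, ?_⟩
      · calc ξ * δ * s = ξ * (δ * s) := by ring
          _ ≤ ξ * a := by gcongr; exact Nat.le_ceil _
          _ ≤ s' := h3
      · intro t' ht' hB
        by_cases htt : t' = t
        · subst htt
          have e1 : (cnt T (fun i => V' (t' i)) : ℝ) ≤ cnt T S' := by
            have : cnt T (fun i => V' (t' i)) ≤ cnt T S' := by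
              apply cnt_mono
              intro i
              rw [← hV2t i]
              exact h1 _
            exact_mod_cast this
          calc _ ≤ c * (a : ℝ) ^ m := e1.trans hS'cnt
            _ = c' * (ξ * a) ^ m := by rw [hc, mul_pow]; ring
            _ ≤ c' * (s' : ℝ) ^ m := by gcongr
        · exact h6 t' (Finset.mem_erase.2 ⟨htt, ht'⟩) ((Finset.mem_insert.1 hB).resolve_left htt)
      · intro t' ht' hB
        rw [Finset.mem_insert, not_or] at hB
        exact h7 t' (Finset.mem_erase.2 ⟨hB.1, ht'⟩) hB.2

theorem cnt_eq {ι : Type*} [Fintype ι] [DecidableEq ι] (T : (ι → ℕ) → Prop) [DecidablePred T]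
    (S : ι → Finset ℕ) : cnt T S = ((Fintype.piFinset S).filter T).card := by
  unfold cnt
  congr!

theorem sum_ind_eq_card {α : Type*} (A : Finset α) (P : α → Prop) [DecidablePred P] :
    ∑ x ∈ A, (if P x then (1 : ℝ) else 0) = ((A.filter P).card : ℝ) := by
  rw [Finset.sum_ite, Finset.sum_const_zero, Finset.sum_const, add_zero, nsmul_eq_mul, mul_one]

theorem share2_mem {m N : ℕ} {τ τ' : Fin m → Fin N} (h : ¬ Share2 τ τ') (hτ' : Function.Injective τ')
    {i i' j j' : Fin m} (h1 : τ i = τ' j) (h2 : τ i' = τ' j') : i = i' ∧ j = j' := by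
  have hi : i = i' := by
    by_contra hne
    exact h ⟨i, i', j, j', hne, h1, h2⟩
  subst hi
  exact ⟨rfl, hτ' (h1.symm.trans h2)⟩

theorem hom_step {m N s : ℕ} (T : (Fin m → ℕ) → Prop) (U : Fin N → Finset ℕ) (hU : ∀ i, (U i).card = s)
    (𝓖 : Finset (Fin m → Fin N)) (τ : Fin m → Fin N) (hτ : Function.Injective τ)
    (hinj : ∀ τ' ∈ 𝓖, Function.Injective τ') (hsh : ∀ τ' ∈ 𝓖, ¬ Share2 τ τ')
    (δ c : ℝ) (hδ : 0 ≤ δ) (hc : 0 ≤ c) (hs : 0 < s)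
    (hR : Robust T (fun i => U (τ i)) δ c) :
    c * ((cnt (fun x => ∀ τ' ∈ 𝓖, T (x ∘ τ')) U : ℝ) - δ * (s : ℝ) ^ N) ≤
      cnt (fun x => ∀ τ' ∈ insert τ 𝓖, T (x ∘ τ')) U := by
  classical
  have key : ∀ x : Fin N → ℕ,
      c * (∑ z ∈ Fintype.piFinset (fun j => U (τ j)),
        (if ∀ τ' ∈ 𝓖, T (Function.extend τ z x ∘ τ') then (1 : ℝ) else 0) - δ * (s : ℝ) ^ m) ≤
      ∑ z ∈ Fintype.piFinset (fun j => U (τ j)),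
        (if ∀ τ' ∈ insert τ 𝓖, T (Function.extend τ z x ∘ τ') then (1 : ℝ) else 0) := by
    intro x
    rw [sum_ind_eq_card, sum_ind_eq_card]
    set A := (Fintype.piFinset (fun j => U (τ j))).filter
      (fun z => ∀ τ' ∈ 𝓖, T (Function.extend τ z x ∘ τ')) with hA
    by_cases hne : A = ∅
    · rw [hne]
      have : 0 ≤ c * (δ * (s : ℝ) ^ m) := by positivity
      have h2 : (0 : ℝ) ≤ (((Fintype.piFinset (fun j => U (τ j))).filter
        (fun z => ∀ τ' ∈ insert τ 𝓖, T (Function.extend τ z x ∘ τ'))).card : ℝ) := by positivity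
      simp only [Finset.card_empty, Nat.cast_zero, zero_sub]
      linarith
    obtain ⟨a0, ha0⟩ := Finset.nonempty_iff_ne_empty.2 hne
    set S : Fin m → Finset ℕ := fun j => A.image (fun z => z j) with hS
    have hAS : A = Fintype.piFinset S := by
      ext z
      rw [Fintype.mem_piFinset]
      constructor
      · intro hz j
        exact Finset.mem_image_of_mem (fun z => z j) hz
      · intro hz
        have hz' : ∀ j, ∃ a ∈ A, a j = z j := fun j => Finset.mem_image.1 (hz j)
        choose a haA haz using hz'
        rw [hA, Finset.mem_filter]
        constructor
        · rw [Fintype.mem_piFinset]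
          intro j
          rw [← haz j]
          exact Fintype.mem_piFinset.1 (Finset.mem_filter.1 (haA j)).1 j
        · intro τ' hτ'
          by_cases hex : ∃ i j, τ i = τ' j
          · obtain ⟨i, j, hij⟩ := hex
            have h1 := (Finset.mem_filter.1 (haA i)).2 τ' hτ'
            have : Function.extend τ z x ∘ τ' = Function.extend τ (a i) x ∘ τ' := by
              funext k
              simp only [Function.comp]
              by_cases hk : ∃ l, τ l = τ' k
              · obtain ⟨l, hl⟩ := hk
                obtain ⟨rfl, rfl⟩ := share2_mem (hsh τ' hτ') (hinj τ' hτ') hij hl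
                rw [← hl, hτ.extend_apply, hτ.extend_apply, haz]
              · rw [Function.extend_apply' _ _ _ hk, Function.extend_apply' _ _ _ hk]
            rw [this]; exact h1
          · have h1 := (Finset.mem_filter.1 ha0).2 τ' hτ'
            have : Function.extend τ z x ∘ τ' = Function.extend τ a0 x ∘ τ' := by
              funext k
              simp only [Function.comp]
              have hk : ¬ ∃ l, τ l = τ' k := fun ⟨l, hl⟩ => hex ⟨l, k, hl⟩
              rw [Function.extend_apply' _ _ _ hk, Function.extend_apply' _ _ _ hk]
            rw [this]; exact h1
    have hSU : ∀ j, S j ⊆ U (τ j) := by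
      intro j y hy
      obtain ⟨z, hz, rfl⟩ := Finset.mem_image.1 hy
      exact Fintype.mem_piFinset.1 (Finset.mem_filter.1 hz).1 j
    have hAc : (A.card : ℝ) = ∏ j, ((S j).card : ℝ) := by
      rw [hAS, Fintype.card_piFinset]; push_cast; rfl
    by_cases hbig : ∀ j, δ * (U (τ j)).card ≤ (S j).card
    · have h1 := hR S hSU hbig
      rw [← hAc] at h1
      have h2 : cnt T S ≤ ((Fintype.piFinset (fun j => U (τ j))).filter
        (fun z => ∀ τ' ∈ insert τ 𝓖, T (Function.extend τ z x ∘ τ'))).card := by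
        apply Finset.card_le_card
        intro z hz
        obtain ⟨hz1, hz2⟩ := Finset.mem_filter.1 hz
        rw [← hAS] at hz1
        obtain ⟨hz3, hz4⟩ := Finset.mem_filter.1 hz1
        rw [Finset.mem_filter]
        refine ⟨hz3, fun τ' hτ' => ?_⟩
        rcases Finset.mem_insert.1 hτ' with rfl | h
        · have : Function.extend τ' z x ∘ τ' = z := funext fun k => hτ.extend_apply _ _ _
          rw [this]; exact hz2
        · exact hz4 τ' h
      have h3 : (cnt T S : ℝ) ≤ (((Fintype.piFinset (fun j => U (τ j))).filter
        (fun z => ∀ τ' ∈ insert τ 𝓖, T (Function.extend τ z x ∘ τ'))).card : ℝ) := by exact_mod_cast h2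
      have : 0 ≤ c * (δ * (s : ℝ) ^ m) := by positivity
      linarith
    · push Not at hbig
      obtain ⟨j, hj⟩ := hbig
      have h1 : (A.card : ℝ) ≤ δ * (s : ℝ) ^ m := by
        rw [hAc, ← Finset.mul_prod_erase _ _ (Finset.mem_univ j)]
        have e1 : ∏ i ∈ Finset.univ.erase j, ((S i).card : ℝ) ≤ (s : ℝ) ^ (m - 1) := by
          calc _ ≤ ∏ i ∈ Finset.univ.erase j, (s : ℝ) := by
                apply Finset.prod_le_prod
                · intro i _; exact Nat.cast_nonneg _
                · intro i _
                  have := Finset.card_le_card (hSU i)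
                  rw [hU] at this
                  exact_mod_cast this
            _ = _ := by simp
        rw [hU] at hj
        have hm : m = (m - 1) + 1 := by have := j.2; omega
        calc _ ≤ (δ * s) * (s : ℝ) ^ (m - 1) := by
              exact mul_le_mul hj.le e1 (Finset.prod_nonneg fun i _ => Nat.cast_nonneg _) (mul_nonneg hδ (Nat.cast_nonneg _))
          _ = δ * (s : ℝ) ^ (m - 1 + 1) := by ring
          _ = _ := by rw [← hm]
      have h2 : (0 : ℝ) ≤ (((Fintype.piFinset (fun j => U (τ j))).filter
        (fun z => ∀ τ' ∈ insert τ 𝓖, T (Function.extend τ z x ∘ τ'))).card : ℝ) := Nat.cast_nonneg _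
      have : c * ((A.card : ℝ) - δ * (s : ℝ) ^ m) ≤ 0 :=
        mul_nonpos_of_nonneg_of_nonpos hc (by linarith)
      linarith
  have hsum := Finset.sum_le_sum (fun x (_ : x ∈ Fintype.piFinset U) => key x)
  rw [← Finset.mul_sum, Finset.sum_sub_distrib,
    resample U τ hτ (fun x => if ∀ τ' ∈ 𝓖, T (x ∘ τ') then (1 : ℝ) else 0),
    resample U τ hτ (fun x => if ∀ τ' ∈ insert τ 𝓖, T (x ∘ τ') then (1 : ℝ) else 0),
    sum_ind_eq_card, sum_ind_eq_card] at hsum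
  simp only [hU, Finset.prod_const, Finset.card_univ, Fintype.card_fin, Finset.sum_const,
    Fintype.card_piFinset, nsmul_eq_mul] at hsum
  have hsm : (0 : ℝ) < (s : ℝ) ^ m := by positivity
  refine le_of_mul_le_mul_left ?_ hsm
  have e1 : cnt (fun x => ∀ τ' ∈ 𝓖, T (x ∘ τ')) U =
    ((Fintype.piFinset U).filter (fun x => ∀ τ' ∈ 𝓖, T (x ∘ τ'))).card := by
    rw [cnt_eq]
  have e2 : cnt (fun x => ∀ τ' ∈ insert τ 𝓖, T (x ∘ τ')) U =
    ((Fintype.piFinset U).filter (fun x => ∀ τ' ∈ insert τ 𝓖, T (x ∘ τ'))).card := by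
    rw [cnt_eq]
  rw [e1, e2]
  refine le_trans (le_of_eq ?_) hsum
  push_cast
  ring

theorem hom_pos {m N s : ℕ} (T : (Fin m → ℕ) → Prop) (U : Fin N → Finset ℕ) (hU : ∀ i, (U i).card = s)
    (hs : 0 < s) (δ c : ℝ) (hδ : 0 ≤ δ) (hc : 0 ≤ c) (hc1 : c ≤ 1)
    (𝓖 : Finset (Fin m → Fin N)) :
    (∀ τ' ∈ 𝓖, Function.Injective τ') → (∀ τ ∈ 𝓖, ∀ τ' ∈ 𝓖, τ ≠ τ' → ¬ Share2 τ τ') →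
    (∀ τ ∈ 𝓖, Robust T (fun i => U (τ i)) δ c) →
    (c ^ 𝓖.card - 𝓖.card * δ) * (s : ℝ) ^ N ≤ cnt (fun x => ∀ τ' ∈ 𝓖, T (x ∘ τ')) U := by
  classical
  induction 𝓖 using Finset.induction_on with
  | empty =>
    intro _ _ _
    simp only [Finset.card_empty, pow_zero, Nat.cast_zero, zero_mul, sub_zero, one_mul]
    have : cnt (fun x : Fin N → ℕ => ∀ τ' ∈ (∅ : Finset (Fin m → Fin N)), T (x ∘ τ')) U = s ^ N := by
      rw [cnt_eq, Finset.filter_true_of_mem]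
      · simp [hU]
      · intro x _ τ' h; simp at h
    rw [this]; push_cast; exact le_refl _
  | insert τ 𝓖 hn ih =>
    intro h1 h2 h3
    have ih' := ih (fun t ht => h1 t (Finset.mem_insert_of_mem ht))
      (fun t ht t' ht' => h2 t (Finset.mem_insert_of_mem ht) t' (Finset.mem_insert_of_mem ht'))
      (fun t ht => h3 t (Finset.mem_insert_of_mem ht))
    have hst := hom_step T U hU 𝓖 τ (h1 τ (Finset.mem_insert_self _ _))
      (fun t ht => h1 t (Finset.mem_insert_of_mem ht))
      (fun t ht => h2 τ (Finset.mem_insert_self _ _) t (Finset.mem_insert_of_mem ht)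
        (fun h => hn (h ▸ ht))) δ c hδ hc hs (h3 τ (Finset.mem_insert_self _ _))
    refine le_trans ?_ hst
    rw [Finset.card_insert_of_notMem hn]
    have hsN : (0 : ℝ) < (s : ℝ) ^ N := by positivity
    have e1 : c * ((c ^ 𝓖.card - 𝓖.card * δ) * (s : ℝ) ^ N - δ * (s : ℝ) ^ N) ≤
      c * ((cnt (fun x => ∀ τ' ∈ 𝓖, T (x ∘ τ')) U : ℝ) - δ * (s : ℝ) ^ N) := by gcongr
    refine le_trans ?_ e1
    have e2 : c * ((c ^ 𝓖.card - 𝓖.card * δ) * (s : ℝ) ^ N - δ * (s : ℝ) ^ N)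
      = (c ^ (𝓖.card + 1) - c * ((𝓖.card + 1) * δ)) * (s : ℝ) ^ N := by ring
    rw [e2]
    have e3 : c * (((𝓖.card : ℝ) + 1) * δ) ≤ 1 * ((𝓖.card + 1) * δ) := by gcongr
    push_cast
    apply mul_le_mul_of_nonneg_right _ hsN.le
    linarith

theorem smallest (S : Finset ℕ) : ∀ s ≤ S.card, ∃ S0 ⊆ S, S0.card = s ∧ ∀ u ∈ S0, ∀ v ∈ S \ S0, u < v := by
  intro s
  induction s with
  | zero => intro _; exact ⟨∅, by simp, by simp, by simp⟩
  | succ s ih =>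
    intro h
    obtain ⟨S0, h1, h2, h3⟩ := ih (by omega)
    have hne : (S \ S0).Nonempty := by
      rw [← Finset.card_pos, Finset.card_sdiff_of_subset h1]; omega
    have hmem := Finset.min'_mem _ hne
    set x := (S \ S0).min' hne with hx
    have hmem' := Finset.mem_sdiff.1 hmem
    refine ⟨insert x S0, Finset.insert_subset hmem'.1 h1, ?_, ?_⟩
    · rw [Finset.card_insert_of_notMem hmem'.2, h2]
    · intro u hu v hv
      rw [Finset.mem_sdiff, Finset.mem_insert, not_or] at hv
      have hv' : v ∈ S \ S0 := Finset.mem_sdiff.2 ⟨hv.1, hv.2.2⟩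
      rcases Finset.mem_insert.1 hu with rfl | hu
      · exact lt_of_le_of_ne (Finset.min'_le _ _ hv') (fun h => hv.2.1 h.symm)
      · exact h3 u hu v hv'

open Classical in
theorem block_process (q : ℕ) : ∀ L : ℕ, ∃ δ : ℝ, 0 < δ ∧ δ ≤ 1 ∧
    ∀ (A : ℕ → ℕ → Prop) (S : Finset ℕ) (s : ℕ), 0 < s → (s : ℝ) ≤ δ * S.card →
    ∃ (V : ℕ → Finset ℕ) (α : ℕ → ℕ), (∀ i < L, V i ⊆ S ∧ (V i).card = s ∧ α i ≤ q) ∧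
      (∀ i j, i < j → j < L → ∀ u ∈ V i, ∀ v ∈ V j, u < v) ∧
      (∀ i j, i < j → j < L → ∀ v ∈ V j, α i * s ≤ q * ((V i).filter (fun u => A u v)).card ∧
        q * ((V i).filter (fun u => A u v)).card ≤ (α i + 1) * s) := by
  intro L
  induction L with
  | zero =>
    exact ⟨1, one_pos, le_refl _, fun A S s _ _ => ⟨fun _ => ∅, fun _ => 0, by simp, by simp, by simp⟩⟩
  | succ L ih =>
    obtain ⟨δ, hδ, hδ1, H⟩ := ih
    have hq1 : (1 : ℝ) ≤ (q : ℝ) + 1 := by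
      have : (0 : ℝ) ≤ q := Nat.cast_nonneg _
      linarith
    have hdle : δ / (2 * (q + 1)) ≤ 1 / 2 := by
      rw [div_le_div_iff₀ (by positivity) (by norm_num)]
      nlinarith
    refine ⟨δ / (2 * (q + 1)), by positivity, hdle.trans (by norm_num), fun A S s hs hsS => ?_⟩
    have hS0 : (0 : ℝ) ≤ S.card := Nat.cast_nonneg _
    have hhalf : (s : ℝ) ≤ 1 / 2 * S.card := hsS.trans (by gcongr)
    have hsle : s ≤ S.card := by
      have : (s : ℝ) ≤ S.card := by linarith
      exact_mod_cast this
    obtain ⟨S0, h1, h2, h3⟩ := smallest S s hsle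
    set f : ℕ → ℕ := fun v => q * (S0.filter (fun u => A u v)).card / s with hf
    have hfq : ∀ v, f v ≤ q := by
      intro v
      apply Nat.div_le_of_le_mul
      rw [mul_comm s q]
      apply Nat.mul_le_mul_left
      rw [← h2]
      exact Finset.card_filter_le _ _
    have hpig : ∃ y ∈ Finset.range (q + 1), (S \ S0).card ≤ (q + 1) * ((S \ S0).filter (fun v => f v = y)).card := by
      by_contra hcon
      push Not at hcon
      have e1 := Finset.card_eq_sum_card_fiberwise (s := S \ S0) (t := Finset.range (q + 1)) (f := f)
        (fun v _ => by simp only [Finset.coe_range, Set.mem_Iio]; exact Nat.lt_succ_of_le (hfq v))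
      have e2 : ∑ y ∈ Finset.range (q + 1), (q + 1) * ((S \ S0).filter (fun v => f v = y)).card <
          ∑ y ∈ Finset.range (q + 1), (S \ S0).card :=
        Finset.sum_lt_sum_of_nonempty (by simp) hcon
      rw [← Finset.mul_sum, ← e1] at e2
      simp at e2
    obtain ⟨y, hy, hyc⟩ := hpig
    set R := (S \ S0).filter (fun v => f v = y) with hR
    have hRS : R ⊆ S \ S0 := Finset.filter_subset _ _
    have hRc : (s : ℝ) ≤ δ * R.card := by
      have e1 : ((S \ S0).card : ℝ) ≤ (q + 1) * R.card := by exact_mod_cast hyc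
      have e2 : ((S \ S0).card : ℝ) = S.card - s := by
        rw [Finset.card_sdiff_of_subset h1, h2, Nat.cast_sub hsle]
      have e3 : 1 / 2 * (S.card : ℝ) ≤ (q + 1) * R.card := by linarith
      calc (s : ℝ) ≤ δ / (2 * (q + 1)) * S.card := hsS
        _ = δ / (q + 1) * (1 / 2 * S.card) := by field_simp
        _ ≤ δ / (q + 1) * ((q + 1) * R.card) := by gcongr
        _ = δ * R.card := by field_simp
    obtain ⟨V, α, g1, g2, g3⟩ := H A R s hs hRc
    refine ⟨fun i => Nat.casesOn i S0 V, fun i => Nat.casesOn i y α, ?_, ?_, ?_⟩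
    · intro i hi
      cases i with
      | zero => exact ⟨h1, h2, by simpa [Nat.lt_succ_iff] using hy⟩
      | succ i =>
        obtain ⟨a1, a2, a3⟩ := g1 i (by omega)
        exact ⟨a1.trans (hRS.trans Finset.sdiff_subset), a2, a3⟩
    · intro i j hij hj u hu v hv
      cases j with
      | zero => omega
      | succ j =>
        cases i with
        | zero => exact h3 u hu v (hRS ((g1 j (by omega)).1 hv))
        | succ i => exact g2 i j (by omega) (by omega) u hu v hv
    · intro i j hij hj v hv
      cases j with
      | zero => omega
      | succ j =>
        cases i with
        | zero =>
          have hv' := (Finset.mem_filter.1 ((g1 j (by omega)).1 hv)).2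
          simp only
          rw [← hv']
          constructor
          · exact Nat.div_mul_le_self _ _
          · exact (Nat.lt_mul_of_div_lt (Nat.lt_succ_self _) hs).le
        | succ i => exact g3 i j (by omega) (by omega) v hv

/-- Ordered blocks of equal size. -/
def Blocks (J : Finset ℕ) (V : ℕ → Finset ℕ) (s : ℕ) : Prop :=
  (∀ i ∈ J, (V i).card = s) ∧ ∀ i ∈ J, ∀ j ∈ J, i < j → ∀ u ∈ V i, ∀ v ∈ V j, u < v

theorem Blocks.unique {J : Finset ℕ} {V : ℕ → Finset ℕ} {s : ℕ} (h : Blocks J V s) {i j x : ℕ}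
    (hi : i ∈ J) (hj : j ∈ J) (hxi : x ∈ V i) (hxj : x ∈ V j) : i = j := by
  rcases lt_trichotomy i j with hij | hij | hij
  · exact absurd (h.2 i hi j hj hij x hxi x hxj) (lt_irrefl _)
  · exact hij
  · exact absurd (h.2 j hj i hi hij x hxj x hxi) (lt_irrefl _)

theorem Blocks.card {J : Finset ℕ} {V : ℕ → Finset ℕ} {s : ℕ} (h : Blocks J V s) :
    (J.biUnion V).card = J.card * s := by
  rw [Finset.card_biUnion]
  · rw [Finset.sum_congr rfl h.1]; simp
  · intro i hi j hj hij
    rw [Function.onFun, Finset.disjoint_left]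
    intro x hx hx'
    exact hij (h.unique hi hj hx hx')

theorem Blocks.mono {J J' : Finset ℕ} {V : ℕ → Finset ℕ} {s : ℕ} (h : Blocks J V s) (hJ : J' ⊆ J) :
    Blocks J' V s :=
  ⟨fun i hi => h.1 i (hJ hi), fun i hi j hj => h.2 i (hJ hi) j (hJ hj)⟩

theorem block_count {m : ℕ} {J : Finset ℕ} {V : ℕ → Finset ℕ} {s : ℕ} (h : Blocks J V s) (hs : 0 < s)
    (hJ : 0 < J.card) (P : (Fin m → ℕ) → Prop) :
    (cnt (fun w => StrictMono w ∧ P w) (fun _ => J.biUnion V) : ℝ) ≤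
      (m : ℝ) ^ 2 / J.card * ((J.card * s : ℕ) : ℝ) ^ m +
      ∑ t ∈ (Fintype.piFinset (fun _ : Fin m => J)).filter StrictMono, (cnt P (fun i => V (t i)) : ℝ) := by
  classical
  set S := J.biUnion V with hS
  have hScard : S.card = J.card * s := h.card
  have hb : ∀ x, ∃ i, x ∈ S → i ∈ J ∧ x ∈ V i := by
    intro x
    by_cases hx : x ∈ S
    · obtain ⟨i, hi, hxi⟩ := Finset.mem_biUnion.1 hx
      exact ⟨i, fun _ => ⟨hi, hxi⟩⟩
    · exact ⟨0, fun h => absurd h hx⟩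
  choose b hb using hb
  set Bad : Fin m × Fin m → Finset (Fin m → ℕ) := fun p =>
    (Fintype.piFinset (fun _ : Fin m => S)).filter (fun w => b (w p.1) = b (w p.2)) with hBad
  have hcover : (Fintype.piFinset (fun _ : Fin m => S)).filter (fun w => StrictMono w ∧ P w) ⊆
      (((Finset.univ : Finset (Fin m × Fin m)).filter (fun p => p.1 ≠ p.2)).biUnion Bad) ∪
      (((Fintype.piFinset (fun _ : Fin m => J)).filter StrictMono).biUnion fun t =>
        (Fintype.piFinset (fun i => V (t i))).filter P) := by
    intro w hw
    obtain ⟨hwS, hwm, hwP⟩ := Finset.mem_filter.1 hw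
    rw [Fintype.mem_piFinset] at hwS
    rw [Finset.mem_union]
    by_cases hex : ∃ i j, i ≠ j ∧ b (w i) = b (w j)
    · left
      obtain ⟨i, j, hij, hbij⟩ := hex
      rw [Finset.mem_biUnion]
      exact ⟨(i, j), by simpa using hij, Finset.mem_filter.2 ⟨Fintype.mem_piFinset.2 hwS, hbij⟩⟩
    · right
      push Not at hex
      rw [Finset.mem_biUnion]
      refine ⟨fun i => b (w i), Finset.mem_filter.2 ⟨Fintype.mem_piFinset.2 fun i => (hb _ (hwS i)).1, ?_⟩,
        Finset.mem_filter.2 ⟨Fintype.mem_piFinset.2 fun i => (hb _ (hwS i)).2, hwP⟩⟩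
      intro i j hij
      rcases lt_trichotomy (b (w i)) (b (w j)) with hl | hl | hl
      · exact hl
      · exact absurd hl (hex i j hij.ne)
      · have := h.2 _ (hb _ (hwS j)).1 _ (hb _ (hwS i)).1 hl _ (hb _ (hwS j)).2 _ (hb _ (hwS i)).2
        exact absurd (hwm hij) (by omega)
  have hBadc : ∀ p ∈ (Finset.univ : Finset (Fin m × Fin m)).filter (fun p => p.1 ≠ p.2),
      ((Bad p).card : ℝ) ≤ ((J.card * s : ℕ) : ℝ) ^ m / J.card := by
    intro p hp
    have hne : p.1 ≠ p.2 := (Finset.mem_filter.1 hp).2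
    have hr := resample_one (fun _ : Fin m => S) p.2 (fun w => if b (w p.1) = b (w p.2) then (1 : ℝ) else 0)
    rw [sum_ind_eq_card] at hr
    have hle : ∑ x ∈ Fintype.piFinset (fun _ : Fin m => S), ∑ y ∈ S,
        (if b (Function.update x p.2 y p.1) = b (Function.update x p.2 y p.2) then (1 : ℝ) else 0) ≤
        ∑ x ∈ Fintype.piFinset (fun _ : Fin m => S), (s : ℝ) := by
      apply Finset.sum_le_sum
      intro x hx
      rw [sum_ind_eq_card]
      have hxS := Fintype.mem_piFinset.1 hx p.1
      have : (S.filter (fun y => b (Function.update x p.2 y p.1) = b (Function.update x p.2 y p.2))).card ≤ s := by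
        rw [← h.1 _ (hb _ hxS).1]
        apply Finset.card_le_card
        intro y hy
        obtain ⟨hyS, hy2⟩ := Finset.mem_filter.1 hy
        rw [Function.update_self, Function.update_of_ne hne] at hy2
        rw [hy2]
        exact (hb y hyS).2
      exact_mod_cast this
    rw [hr] at hle
    simp only [Finset.sum_const, Fintype.card_piFinset, Finset.prod_const, Finset.card_univ,
      Fintype.card_fin, nsmul_eq_mul, hScard] at hle
    rw [le_div_iff₀ (by exact_mod_cast hJ)]
    have hs' : (0 : ℝ) < s := by exact_mod_cast hs
    refine le_of_mul_le_mul_right ?_ hs'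
    refine le_trans (le_of_eq ?_) (le_trans hle (le_of_eq ?_))
    · push_cast; ring
    · push_cast; ring
  rw [cnt_eq]
  have hc1 := (Finset.card_le_card hcover).trans (Finset.card_union_le _ _)
  have hc2 := hc1.trans (Nat.add_le_add Finset.card_biUnion_le Finset.card_biUnion_le)
  have hc3 : (((Fintype.piFinset (fun _ : Fin m => S)).filter (fun w => StrictMono w ∧ P w)).card : ℝ) ≤
    ∑ p ∈ (Finset.univ : Finset (Fin m × Fin m)).filter (fun p => p.1 ≠ p.2), ((Bad p).card : ℝ) +
    ∑ t ∈ (Fintype.piFinset (fun _ : Fin m => J)).filter StrictMono,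
      (((Fintype.piFinset (fun i => V (t i))).filter P).card : ℝ) := by exact_mod_cast hc2
  refine hc3.trans (add_le_add ?_ (le_of_eq ?_))
  · refine (Finset.sum_le_sum hBadc).trans ?_
    rw [Finset.sum_const, nsmul_eq_mul]
    have : (((Finset.univ : Finset (Fin m × Fin m)).filter (fun p => p.1 ≠ p.2)).card : ℝ) ≤ (m : ℝ) ^ 2 := by
      have := Finset.card_filter_le (Finset.univ : Finset (Fin m × Fin m)) (fun p => p.1 ≠ p.2)
      simp only [Finset.card_univ, Fintype.card_prod, Fintype.card_fin] at this
      rw [sq]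
      exact_mod_cast this
    calc _ ≤ (m : ℝ) ^ 2 * (((J.card * s : ℕ) : ℝ) ^ m / J.card) := by gcongr
      _ = _ := by ring
  · apply Finset.sum_congr rfl
    intro t _
    rw [cnt_eq]

/-- The number of block tuples. -/
theorem block_choose {r : ℕ} {J : Finset ℕ} {V : ℕ → Finset ℕ} {s : ℕ} (h : Blocks J V s) :
    J.card.choose r * s ^ r ≤ (J.biUnion V).card.choose r := by
  classical
  rw [← card_strictMono', ← card_strictMono']
  have : ∑ t ∈ (Fintype.piFinset (fun _ : Fin r => J)).filter StrictMono,
      (Fintype.piFinset (fun i => V (t i))).card =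
      ((Fintype.piFinset (fun _ : Fin r => J)).filter StrictMono).card * s ^ r := by
    rw [Finset.sum_congr rfl (g := fun _ => s ^ r)]
    · simp
    · intro t ht
      have ht' := Fintype.mem_piFinset.1 (Finset.mem_filter.1 ht).1
      rw [Fintype.card_piFinset, Finset.prod_congr rfl (fun i _ => h.1 _ (ht' i))]
      simp
  rw [← this, ← Finset.card_biUnion]
  · apply Finset.card_le_card
    intro w hw
    obtain ⟨t, ht, hwt⟩ := Finset.mem_biUnion.1 hw
    obtain ⟨ht1, ht2⟩ := Finset.mem_filter.1 ht
    rw [Fintype.mem_piFinset] at ht1 hwt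
    refine Finset.mem_filter.2 ⟨Fintype.mem_piFinset.2 fun i => Finset.mem_biUnion.2 ⟨t i, ht1 i, hwt i⟩, ?_⟩
    intro i j hij
    exact h.2 _ (ht1 i) _ (ht1 j) (ht2 hij) _ (hwt i) _ (hwt j)
  · intro t ht t' ht' hne
    rw [Function.onFun, Finset.disjoint_left]
    intro w hw hw'
    apply hne
    funext i
    exact h.unique (Fintype.mem_piFinset.1 (Finset.mem_filter.1 ht).1 i)
      (Fintype.mem_piFinset.1 (Finset.mem_filter.1 ht').1 i)
      (Fintype.mem_piFinset.1 hw i) (Fintype.mem_piFinset.1 hw' i)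

open Classical in
theorem pcount {r s q a : ℕ} (U : Fin r → Finset ℕ) (hU : ∀ i, (U i).card = s) (hs : 0 < s) (hq : 0 < q)
    (haq : a ≤ q) (i0 i1 j0 j1 : Fin r) (h01 : i0 ≠ i1) (h0j : i0 ≠ j0) (h0j1 : i0 ≠ j1) (hj : j0 ≠ j1)
    (A : ℕ → ℕ → Prop)
    (hA0 : ∀ v ∈ U i1, q * ((U i0).filter (fun u => A u v)).card ≤ (a + 1) * s)
    (hA1 : ∀ v ∈ U j1, a * s ≤ q * ((U j0).filter (fun u => A u v)).card) :
    (cnt (fun x => A (x i0) (x i1) ∧ ¬ A (x j0) (x j1)) U : ℝ) ≤ (1 / 4 + 1 / q) * (s : ℝ) ^ r := by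
  have hs' : (0 : ℝ) < s := by exact_mod_cast hs
  have hq' : (0 : ℝ) < q := by exact_mod_cast hq
  have haq' : (a : ℝ) ≤ q := by exact_mod_cast haq
  have ha0 : (0 : ℝ) ≤ a := Nat.cast_nonneg _
  set M : ℝ := ∑ x ∈ Fintype.piFinset U, (if ¬ A (x j0) (x j1) then (1 : ℝ) else 0) with hM
  have hM1 : M ≤ (1 - a / q) * (s : ℝ) ^ r := by
    have hr := resample_one U j0 (fun x => if ¬ A (x j0) (x j1) then (1 : ℝ) else 0)
    have hle : ∑ x ∈ Fintype.piFinset U, ∑ y ∈ U j0,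
        (if ¬ A (Function.update x j0 y j0) (Function.update x j0 y j1) then (1 : ℝ) else 0) ≤
        ∑ x ∈ Fintype.piFinset U, ((1 - (a : ℝ) / q) * s) := by
      apply Finset.sum_le_sum
      intro x hx
      have hx1 := Fintype.mem_piFinset.1 hx j1
      simp only [Function.update_self, Function.update_of_ne hj.symm]
      rw [sum_ind_eq_card]
      have e1 := Finset.card_filter_add_card_filter_not (s := U j0) (fun u => A u (x j1))
      rw [hU] at e1
      have e2 := hA1 _ hx1
      have e1' : ((((U j0).filter (fun u => A u (x j1))).card : ℝ)) +
        (((U j0).filter (fun u => ¬ A u (x j1))).card : ℝ) = s := by exact_mod_cast e1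
      have e2' : (a : ℝ) * s ≤ q * (((U j0).filter (fun u => A u (x j1))).card : ℝ) := by exact_mod_cast e2
      have e3 : (a : ℝ) / q * s ≤ (((U j0).filter (fun u => A u (x j1))).card : ℝ) := by
        rw [div_mul_eq_mul_div, div_le_iff₀ hq']; linarith
      linarith
    rw [hr, hU, Finset.sum_const, Fintype.card_piFinset] at hle
    simp only [hU, Finset.prod_const, Finset.card_univ, Fintype.card_fin, nsmul_eq_mul] at hle
    push_cast at hle
    refine le_of_mul_le_mul_left (hle.trans (le_of_eq ?_)) hs'
    ring
  have hmain : (cnt (fun x => A (x i0) (x i1) ∧ ¬ A (x j0) (x j1)) U : ℝ) ≤ (a + 1) / q * M := by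
    have hr := resample_one U i0 (fun x => if A (x i0) (x i1) ∧ ¬ A (x j0) (x j1) then (1 : ℝ) else 0)
    have hle : ∑ x ∈ Fintype.piFinset U, ∑ y ∈ U i0,
        (if A (Function.update x i0 y i0) (Function.update x i0 y i1) ∧
          ¬ A (Function.update x i0 y j0) (Function.update x i0 y j1) then (1 : ℝ) else 0) ≤
        ∑ x ∈ Fintype.piFinset U, (((a + 1) / q * s) * (if ¬ A (x j0) (x j1) then (1 : ℝ) else 0)) := by
      apply Finset.sum_le_sum
      intro x hx
      have hx1 := Fintype.mem_piFinset.1 hx i1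
      simp only [Function.update_self, Function.update_of_ne h01.symm, Function.update_of_ne h0j.symm,
        Function.update_of_ne h0j1.symm]
      by_cases hc : A (x j0) (x j1)
      · simp [hc]
      · simp only [hc, not_false_eq_true, and_true, if_true, mul_one]
        rw [sum_ind_eq_card]
        have e2 := hA0 _ hx1
        have e2' : q * (((U i0).filter (fun u => A u (x i1))).card : ℝ) ≤ (a + 1 : ℝ) * s := by exact_mod_cast e2
        rw [div_mul_eq_mul_div, le_div_iff₀ hq']; linarith
    rw [hr, hU, ← Finset.mul_sum, sum_ind_eq_card] at hle
    rw [cnt_eq]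
    refine le_of_mul_le_mul_left (hle.trans (le_of_eq ?_)) hs'
    ring
  have hsr : (0 : ℝ) < (s : ℝ) ^ r := by positivity
  calc _ ≤ _ := hmain
    _ ≤ (a + 1) / q * ((1 - a / q) * (s : ℝ) ^ r) := by gcongr
    _ = ((a + 1) / q * (1 - a / q)) * (s : ℝ) ^ r := by ring
    _ ≤ _ := by
      apply mul_le_mul_of_nonneg_right _ hsr.le
      set b : ℝ := a / q
      have hb : 0 ≤ b := by positivity
      have hi : 0 ≤ 1 / (q : ℝ) := by positivity
      have : ((a : ℝ) + 1) / q = b + 1 / q := by rw [add_div]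
      rw [this]
      nlinarith [sq_nonneg (b - 1 / 2), mul_nonneg hi hb]

/-- Ordered edges. -/
def Ep {r : ℕ} (E : Finset (Finset ℕ)) (x : Fin r → ℕ) : Prop :=
  StrictMono x ∧ Finset.univ.image x ∈ E

def fstI {r : ℕ} (hr : 3 ≤ r) (i : Fin r) : Fin (2 * r - 2) := ⟨i.1, by have := i.2; omega⟩

def lstI {r : ℕ} (hr : 3 ≤ r) (i : Fin r) : Fin (2 * r - 2) := ⟨i.1 + (r - 2), by have := i.2; omega⟩

theorem fstI_strictMono {r : ℕ} (hr : 3 ≤ r) : StrictMono (fstI hr) := fun _ _ h => h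

theorem lstI_strictMono {r : ℕ} (hr : 3 ≤ r) : StrictMono (lstI hr) := fun i j h => by
  have h' : i.1 < j.1 := h
  show i.1 + (r - 2) < j.1 + (r - 2)
  omega

def TT {r : ℕ} (hr : 3 ≤ r) (E : Finset (Finset ℕ)) (w : Fin (2 * r - 2) → ℕ) : Prop :=
  Ep E (w ∘ fstI hr) ∧ Ep E (w ∘ lstI hr)

theorem TT.strictMono {r : ℕ} {hr : 3 ≤ r} {E : Finset (Finset ℕ)} {w : Fin (2 * r - 2) → ℕ}
    (h : TT hr E w) : StrictMono w := by
  have hf : ∀ i j : Fin (2 * r - 2), i < j → j.1 < r → w i < w j := by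
    intro i j hij hj
    have hij' : i.1 < j.1 := hij
    exact h.1.1 (show (⟨i.1, by omega⟩ : Fin r) < ⟨j.1, by omega⟩ from hij)
  have hl : ∀ i j : Fin (2 * r - 2), i < j → r - 2 ≤ i.1 → w i < w j := by
    intro i j hij hi
    have hij' : i.1 < j.1 := hij
    have := h.2.1 (show (⟨i.1 - (r - 2), by have := i.2; omega⟩ : Fin r) <
      ⟨j.1 - (r - 2), by have := j.2; omega⟩ from (show i.1 - (r - 2) < j.1 - (r - 2) by omega))
    have e1 : lstI hr ⟨i.1 - (r - 2), by have := i.2; omega⟩ = i := Fin.ext (by simp only [lstI]; omega)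
    have e2 : lstI hr ⟨j.1 - (r - 2), by have := j.2; omega⟩ = j := Fin.ext (by simp only [lstI]; omega)
    simpa only [Function.comp, e1, e2] using this
  intro i j hij
  have hij' : i.1 < j.1 := hij
  by_cases hj : j.1 < r
  · exact hf i j hij hj
  by_cases hi : r - 2 ≤ i.1
  · exact hl i j hij hi
  · have hk : r - 2 < 2 * r - 2 := by omega
    exact (hf i ⟨r - 2, hk⟩ (show i.1 < r - 2 by omega) (by simp only; omega)).trans
      (hl ⟨r - 2, hk⟩ j (show r - 2 < j.1 by omega) (le_refl _))

/-- Gluing two ordered edges along tail and head. -/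
def glue {r : ℕ} (x y : Fin r → ℕ) (i : Fin (2 * r - 2)) : ℕ :=
  if h : i.1 < r then x ⟨i.1, h⟩ else y ⟨i.1 - (r - 2), by have := i.2; omega⟩

theorem glue_of_lt {r : ℕ} (x y : Fin r → ℕ) (i : Fin (2 * r - 2)) (h : i.1 < r) :
    glue x y i = x ⟨i.1, h⟩ := dif_pos h

theorem glue_of_ge {r : ℕ} (x y : Fin r → ℕ) (i : Fin (2 * r - 2)) (h : ¬ i.1 < r) :
    glue x y i = y ⟨i.1 - (r - 2), by have := i.2; omega⟩ := dif_neg h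

theorem glue_fst {r : ℕ} (hr : 3 ≤ r) (x y : Fin r → ℕ) : glue x y ∘ fstI hr = x := by
  funext i
  exact glue_of_lt x y (fstI hr i) i.2

theorem glue_lst {r : ℕ} (hr : 3 ≤ r) (x y : Fin r → ℕ)
    (h0 : x ⟨r - 2, by omega⟩ = y ⟨0, by omega⟩) (h1 : x ⟨r - 1, by omega⟩ = y ⟨1, by omega⟩) :
    glue x y ∘ lstI hr = y := by
  funext i
  by_cases h : (lstI hr i).1 < r
  · refine (glue_of_lt x y (lstI hr i) h).trans ?_
    rcases i with ⟨i, hi⟩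
    have h' : i + (r - 2) < r := h
    have : i = 0 ∨ i = 1 := by omega
    rcases this with rfl | rfl
    · rw [← h0]; congr 1; apply Fin.ext; show 0 + (r - 2) = r - 2; omega
    · rw [← h1]; congr 1; apply Fin.ext; show 1 + (r - 2) = r - 1; omega
  · refine (glue_of_ge x y (lstI hr i) h).trans ?_
    congr 1
    apply Fin.ext; show i.1 + (r - 2) - (r - 2) = i.1; omega

open Classical in
theorem count_low_head {r : ℕ} (hr : 3 ≤ r) (E : Finset (Finset ℕ)) (S : Finset ℕ) (η : ℝ) (hη : 0 ≤ η)
    (A : ℕ → ℕ → Prop)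
    (hA : ∀ u v, ¬ A u v → (cnt (fun x : Fin r → ℕ => Ep E x ∧ x ⟨0, by omega⟩ = u ∧ x ⟨1, by omega⟩ = v)
      (fun _ => S) : ℝ) ≤ η * (S.card : ℝ) ^ (r - 2)) :
    (cnt (fun x : Fin r → ℕ => Ep E x ∧ ¬ A (x ⟨0, by omega⟩) (x ⟨1, by omega⟩)) (fun _ => S) : ℝ) ≤
      η * (S.card : ℝ) ^ r := by
  rw [cnt_eq]
  have hle := Finset.card_le_mul_card_image_of_maps_to
    (s := (Fintype.piFinset (fun _ : Fin r => S)).filter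
      (fun x : Fin r → ℕ => Ep E x ∧ ¬ A (x ⟨0, by omega⟩) (x ⟨1, by omega⟩)))
    (t := S ×ˢ S) (f := fun x => (x ⟨0, by omega⟩, x ⟨1, by omega⟩))
    (fun x hx => by
      have := Fintype.mem_piFinset.1 (Finset.mem_filter.1 hx).1
      exact Finset.mem_product.2 ⟨this _, this _⟩)
    ⌊η * (S.card : ℝ) ^ (r - 2)⌋₊ (by
      rintro ⟨u, v⟩ _
      apply Nat.le_floor
      by_cases huv : A u v
      · rw [Finset.card_eq_zero.2]
        · simp only [Nat.cast_zero]; positivity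
        · rw [Finset.filter_eq_empty_iff]
          intro x hx hxe
          simp only [Prod.mk.injEq] at hxe
          have := (Finset.mem_filter.1 hx).2.2
          rw [hxe.1, hxe.2] at this
          exact this huv
      · refine le_trans ?_ (hA u v huv)
        rw [cnt_eq]
        have : ∀ a b : ℕ, a ≤ b → (a : ℝ) ≤ b := fun a b h => by exact_mod_cast h
        apply this
        apply Finset.card_le_card
        intro x hx
        obtain ⟨hx1, hx2⟩ := Finset.mem_filter.1 hx
        simp only [Prod.mk.injEq] at hx2
        obtain ⟨hx3, hx4⟩ := Finset.mem_filter.1 hx1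
        exact Finset.mem_filter.2 ⟨hx3, hx4.1, hx2.1, hx2.2⟩)
  rw [Finset.card_product] at hle
  have hfl : (⌊η * (S.card : ℝ) ^ (r - 2)⌋₊ : ℝ) ≤ η * (S.card : ℝ) ^ (r - 2) := Nat.floor_le (by positivity)
  calc _ ≤ (⌊η * (S.card : ℝ) ^ (r - 2)⌋₊ : ℝ) * ((S.card : ℝ) * S.card) := by exact_mod_cast hle
    _ ≤ η * (S.card : ℝ) ^ (r - 2) * ((S.card : ℝ) * S.card) := by gcongr
    _ = η * (S.card : ℝ) ^ (r - 2 + 2) := by ring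
    _ = _ := by rw [Nat.sub_add_cancel (by omega)]

open Classical in
theorem count_high_tail {r : ℕ} (hr : 3 ≤ r) (E : Finset (Finset ℕ)) (S : Finset ℕ) (η : ℝ) (hη : 0 < η)
    (hS : 0 < S.card) (A : ℕ → ℕ → Prop)
    (hA : ∀ u v, A u v → η * (S.card : ℝ) ^ (r - 2) ≤
      (cnt (fun x : Fin r → ℕ => Ep E x ∧ x ⟨0, by omega⟩ = u ∧ x ⟨1, by omega⟩ = v) (fun _ => S) : ℝ))
    (hT : (cnt (TT hr E) (fun _ => S) : ℝ) ≤ η ^ 2 * (S.card : ℝ) ^ (2 * r - 2)) :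
    (cnt (fun x : Fin r → ℕ => Ep E x ∧ A (x ⟨r - 2, by omega⟩) (x ⟨r - 1, by omega⟩)) (fun _ => S) : ℝ) ≤
      η * (S.card : ℝ) ^ r := by
  set B := (Fintype.piFinset (fun _ : Fin r => S)).filter
    (fun x : Fin r → ℕ => Ep E x ∧ A (x ⟨r - 2, by omega⟩) (x ⟨r - 1, by omega⟩)) with hB
  set C : (Fin r → ℕ) → Finset (Fin r → ℕ) := fun x => (Fintype.piFinset (fun _ : Fin r => S)).filter
    (fun y : Fin r → ℕ => Ep E y ∧ y ⟨0, by omega⟩ = x ⟨r - 2, by omega⟩ ∧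
      y ⟨1, by omega⟩ = x ⟨r - 1, by omega⟩) with hC
  have hgl : ∀ p ∈ B.sigma C, glue p.1 p.2 ∘ fstI hr = p.1 ∧ glue p.1 p.2 ∘ lstI hr = p.2 := by
    rintro ⟨x, y⟩ hp
    obtain ⟨hx, hy⟩ := Finset.mem_sigma.1 hp
    have hy' := (Finset.mem_filter.1 hy).2
    exact ⟨glue_fst hr x y, glue_lst hr x y hy'.2.1.symm hy'.2.2.symm⟩
  have hcard : (B.sigma C).card ≤ cnt (TT hr E) (fun _ => S) := by
    rw [cnt_eq]
    apply Finset.card_le_card_of_injOn (fun p => glue p.1 p.2)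
    · rintro ⟨x, y⟩ hp
      have hp' := Finset.mem_coe.1 hp
      have hg := hgl _ hp'
      obtain ⟨hx, hy⟩ := Finset.mem_sigma.1 hp'
      have hx' := Finset.mem_filter.1 hx
      have hy' := Finset.mem_filter.1 hy
      rw [Finset.mem_coe, Finset.mem_filter]
      refine ⟨?_, ?_, ?_⟩
      · rw [Fintype.mem_piFinset]
        intro i
        simp only [glue]
        split_ifs
        · exact Fintype.mem_piFinset.1 hx'.1 _
        · exact Fintype.mem_piFinset.1 hy'.1 _
      · rw [hg.1]; exact hx'.2.1
      · rw [hg.2]; exact hy'.2.1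
    · rintro ⟨x, y⟩ hp ⟨x', y'⟩ hp' heq
      have hg := hgl _ (Finset.mem_coe.1 hp)
      have hg' := hgl _ (Finset.mem_coe.1 hp')
      simp only at heq hg hg'
      rw [heq] at hg
      have e1 : x = x' := hg.1.symm.trans hg'.1
      have e2 : y = y' := hg.2.symm.trans hg'.2
      rw [e1, e2]
  rw [Finset.card_sigma] at hcard
  have hlow : (B.card : ℝ) * (η * (S.card : ℝ) ^ (r - 2)) ≤ ((∑ x ∈ B, (C x).card : ℕ) : ℝ) := by
    push_cast
    rw [← nsmul_eq_mul, ← Finset.sum_const]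
    apply Finset.sum_le_sum
    intro x hx
    have := hA _ _ (Finset.mem_filter.1 hx).2.2
    rw [cnt_eq] at this
    exact this
  have hcard' : ((∑ x ∈ B, (C x).card : ℕ) : ℝ) ≤ (cnt (TT hr E) (fun _ => S) : ℝ) := by exact_mod_cast hcard
  rw [cnt_eq]
  have hS' : (0 : ℝ) < S.card := by exact_mod_cast hS
  have hpos : 0 < η * (S.card : ℝ) ^ (r - 2) := by positivity
  refine le_of_mul_le_mul_right ((hlow.trans (hcard'.trans hT)).trans (le_of_eq ?_)) hpos
  have : 2 * r - 2 = r + (r - 2) := by omega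
  rw [this, pow_add]
  ring

theorem card_edges {r : ℕ} (E : Finset (Finset ℕ)) (S : Finset ℕ) [DecidablePred (fun e : Finset ℕ => e ∈ E)] :
    ((Finset.powersetCard r S).filter (fun e => e ∈ E)).card = cnt (Ep (r := r) E) (fun _ => S) := by
  classical
  have h := card_strictMono (r := r) S (fun e => e ∈ E)
  rw [cnt_eq]
  unfold Ep
  convert h.symm using 3

open Classical in
theorem lemK_core {r : ℕ} (hr : 3 ≤ r) {q k s a : ℕ} (hq : 0 < q) (hs : 0 < s) (haq : a ≤ q)
    {J : Finset ℕ} {V : ℕ → Finset ℕ} (hB : Blocks J V s) (hJ : J.card = k) (hk : 0 < k)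
    (E : Finset (Finset ℕ)) (S : Finset ℕ) (hVS : ∀ i ∈ J, V i ⊆ S) (A : ℕ → ℕ → Prop)
    (hA : ∀ i ∈ J, ∀ j ∈ J, i < j → ∀ v ∈ V j, a * s ≤ q * ((V i).filter (fun u => A u v)).card ∧
        q * ((V i).filter (fun u => A u v)).card ≤ (a + 1) * s) :
    (((Finset.powersetCard r (J.biUnion V)).filter (fun e => e ∈ E)).card : ℝ) ≤
      (cnt (fun x : Fin r → ℕ => Ep E x ∧ ¬ A (x ⟨0, by omega⟩) (x ⟨1, by omega⟩)) (fun _ => S) : ℝ) +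
      (cnt (fun x : Fin r → ℕ => Ep E x ∧ A (x ⟨r - 2, by omega⟩) (x ⟨r - 1, by omega⟩)) (fun _ => S) : ℝ) +
      ((r : ℝ) ^ 2 / k * ((k * s : ℕ) : ℝ) ^ r + (1 / 4 + 1 / q) * ((k * s).choose r : ℝ)) := by
  have hSS : J.biUnion V ⊆ S := Finset.biUnion_subset.2 hVS
  rw [card_edges]
  have hb := block_count (m := r) hB hs (by omega) (fun x : Fin r → ℕ => A (x ⟨0, by omega⟩) (x ⟨1, by omega⟩) ∧
    ¬ A (x ⟨r - 2, by omega⟩) (x ⟨r - 1, by omega⟩))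
  rw [hJ] at hb
  have hsum : ∑ t ∈ (Fintype.piFinset (fun _ : Fin r => J)).filter StrictMono,
      (cnt (fun x : Fin r → ℕ => A (x ⟨0, by omega⟩) (x ⟨1, by omega⟩) ∧
        ¬ A (x ⟨r - 2, by omega⟩) (x ⟨r - 1, by omega⟩)) (fun i => V (t i)) : ℝ) ≤
      (1 / 4 + 1 / q) * ((k * s).choose r : ℝ) := by
    have h1 : ∀ t ∈ (Fintype.piFinset (fun _ : Fin r => J)).filter StrictMono,
      (cnt (fun x : Fin r → ℕ => A (x ⟨0, by omega⟩) (x ⟨1, by omega⟩) ∧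
        ¬ A (x ⟨r - 2, by omega⟩) (x ⟨r - 1, by omega⟩)) (fun i => V (t i)) : ℝ) ≤
        (1 / 4 + 1 / q) * (s : ℝ) ^ r := by
      intro t ht
      obtain ⟨ht1, ht2⟩ := Finset.mem_filter.1 ht
      rw [Fintype.mem_piFinset] at ht1
      apply pcount (a := a) (fun i => V (t i)) (fun i => hB.1 _ (ht1 i)) hs hq haq
      · intro h; rw [Fin.mk.injEq] at h; omega
      · intro h; rw [Fin.mk.injEq] at h; omega
      · intro h; rw [Fin.mk.injEq] at h; omega
      · intro h; rw [Fin.mk.injEq] at h; omega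
      · intro v hv
        exact (hA _ (ht1 _) _ (ht1 _) (ht2 (by simp)) v hv).2
      · intro v hv
        exact (hA _ (ht1 _) _ (ht1 _) (ht2 (by simp only [Fin.mk_lt_mk]; omega)) v hv).1
    refine (Finset.sum_le_sum h1).trans ?_
    rw [Finset.sum_const, nsmul_eq_mul, card_strictMono', hJ]
    have h2 := block_choose (r := r) hB
    rw [hB.card, hJ] at h2
    have h3 : ((k.choose r : ℝ)) * (s : ℝ) ^ r ≤ ((k * s).choose r : ℝ) := by exact_mod_cast h2
    calc (k.choose r : ℝ) * ((1 / 4 + 1 / q) * (s : ℝ) ^ r) =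
        (1 / 4 + 1 / q) * ((k.choose r : ℝ) * (s : ℝ) ^ r) := by ring
      _ ≤ _ := by gcongr
  have hcov : cnt (Ep (r := r) E) (fun _ => J.biUnion V) ≤
      cnt (fun x : Fin r → ℕ => Ep E x ∧ ¬ A (x ⟨0, by omega⟩) (x ⟨1, by omega⟩)) (fun _ => S) +
      cnt (fun x : Fin r → ℕ => Ep E x ∧ A (x ⟨r - 2, by omega⟩) (x ⟨r - 1, by omega⟩)) (fun _ => S) +
      cnt (fun x : Fin r → ℕ => StrictMono x ∧ (A (x ⟨0, by omega⟩) (x ⟨1, by omega⟩) ∧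
        ¬ A (x ⟨r - 2, by omega⟩) (x ⟨r - 1, by omega⟩))) (fun _ => J.biUnion V) := by
    rw [cnt_eq, cnt_eq, cnt_eq, cnt_eq]
    refine le_trans (Finset.card_le_card ?_) ((Finset.card_union_le _ _).trans
      (Nat.add_le_add_right (Finset.card_union_le _ _) _))
    intro x hx
    obtain ⟨hx1, hx2⟩ := Finset.mem_filter.1 hx
    have hxS : x ∈ Fintype.piFinset (fun _ : Fin r => S) :=
      Fintype.mem_piFinset.2 fun i => hSS (Fintype.mem_piFinset.1 hx1 i)
    by_cases c1 : A (x ⟨0, by omega⟩) (x ⟨1, by omega⟩)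
    · by_cases c2 : A (x ⟨r - 2, by omega⟩) (x ⟨r - 1, by omega⟩)
      · exact Finset.mem_union_left _ (Finset.mem_union_right _ (Finset.mem_filter.2 ⟨hxS, hx2, c2⟩))
      · exact Finset.mem_union_right _ (Finset.mem_filter.2 ⟨hx1, hx2.1, c1, c2⟩)
    · exact Finset.mem_union_left _ (Finset.mem_union_left _ (Finset.mem_filter.2 ⟨hxS, hx2, c1⟩))
  have hcov' : (cnt (Ep (r := r) E) (fun _ => J.biUnion V) : ℝ) ≤
      (cnt (fun x : Fin r → ℕ => Ep E x ∧ ¬ A (x ⟨0, by omega⟩) (x ⟨1, by omega⟩)) (fun _ => S) : ℝ) +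
      (cnt (fun x : Fin r → ℕ => Ep E x ∧ A (x ⟨r - 2, by omega⟩) (x ⟨r - 1, by omega⟩)) (fun _ => S) : ℝ) +
      (cnt (fun x : Fin r → ℕ => StrictMono x ∧ (A (x ⟨0, by omega⟩) (x ⟨1, by omega⟩) ∧
        ¬ A (x ⟨r - 2, by omega⟩) (x ⟨r - 1, by omega⟩))) (fun _ => J.biUnion V) : ℝ) := by
    exact_mod_cast hcov
  linarith

open Classical in
theorem lemK {r : ℕ} (hr : 3 ≤ r) (ε : ℝ) (hε : 0 < ε) :
    ∃ c δ : ℝ, 0 < c ∧ c ≤ 1 ∧ 0 < δ ∧ ∃ n1 : ℕ, ∀ (E : Finset (Finset ℕ)) (S : Finset ℕ), n1 ≤ S.card →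
      (cnt (TT hr E) (fun _ => S) : ℝ) ≤ c * (S.card : ℝ) ^ (2 * r - 2) →
      ∃ S' ⊆ S, δ * S.card ≤ S'.card ∧
        (((Finset.powersetCard r S').filter (fun e => e ∈ E)).card : ℝ) < (1 / 4 + ε) * (S'.card.choose r : ℝ) := by
  obtain ⟨q0, hq0⟩ := exists_nat_gt (4 / ε)
  have hq0' : (0 : ℝ) < q0 := lt_trans (by positivity) hq0
  have hq : 0 < q0 := by exact_mod_cast hq0'
  have hqe : 1 / (q0 : ℝ) ≤ ε / 4 := by
    rw [div_lt_iff₀ hε] at hq0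
    rw [div_le_div_iff₀ hq0' (by norm_num)]; linarith
  obtain ⟨k, hk0⟩ := exists_nat_gt (4 * ((r : ℝ) ^ 2 * (r : ℝ) ^ r) / ε)
  have hk' : (0 : ℝ) < k := lt_of_le_of_lt (by positivity) hk0
  have hk : 0 < k := by exact_mod_cast hk'
  have hke : (r : ℝ) ^ 2 / k * (r : ℝ) ^ r ≤ ε / 4 := by
    rw [div_lt_iff₀ hε] at hk0
    rw [div_mul_eq_mul_div, div_le_div_iff₀ hk' (by norm_num)]; linarith
  obtain ⟨δ, hδ, hδ1, H⟩ := block_process q0 ((q0 + 1) * k)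
  have hr0 : (0 : ℝ) < r := by exact_mod_cast (by omega : 0 < r)
  set G : ℝ := (2 / δ) ^ r * (r : ℝ) ^ r with hG
  have hG0 : 0 < G := by positivity
  set η : ℝ := min 1 (ε / (16 * G)) with hη
  have hη0 : 0 < η := lt_min one_pos (by positivity)
  have hη1 : η ≤ 1 := min_le_left _ _
  have hηG : η * G ≤ ε / 16 := by
    calc η * G ≤ ε / (16 * G) * G := by gcongr; exact min_le_right _ _
      _ = ε / 16 := by field_simp
  obtain ⟨n1, hn1⟩ := exists_nat_gt (2 * r / δ)
  refine ⟨η ^ 2, δ / 2, by positivity, pow_le_one₀ hη0.le hη1, by positivity, n1, fun E S hS hT => ?_⟩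
  have hSn : 2 * r / δ < (S.card : ℝ) := hn1.trans_le (by exact_mod_cast hS)
  rw [div_lt_iff₀ hδ] at hSn
  have hScard : 0 < S.card := by
    have : (0 : ℝ) < S.card := by
      by_contra hcon
      have : (S.card : ℝ) = 0 := le_antisymm (not_lt.1 hcon) (Nat.cast_nonneg _)
      rw [this] at hSn; linarith
    exact_mod_cast this
  have hr3 : (3 : ℝ) ≤ r := by exact_mod_cast hr
  set s := ⌊δ * (S.card : ℝ)⌋₊ with hs
  have hs1 : (s : ℝ) ≤ δ * S.card := Nat.floor_le (by positivity)
  have hs2 : δ * S.card < s + 1 := Nat.lt_floor_add_one _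
  have hs3 : δ / 2 * S.card ≤ s := by linarith
  have hs4 : (r : ℝ) ≤ s := by linarith
  have hsr : r ≤ s := by exact_mod_cast hs4
  have hs0 : 0 < s := by omega
  set A : ℕ → ℕ → Prop := fun u v => η * (S.card : ℝ) ^ (r - 2) ≤
      (cnt (fun x : Fin r → ℕ => Ep E x ∧ x ⟨0, by omega⟩ = u ∧ x ⟨1, by omega⟩ = v) (fun _ => S) : ℝ) with hA
  obtain ⟨V, α, g1, g2, g3⟩ := H A S s hs0 hs1
  obtain ⟨a, ha, hac⟩ := Finset.exists_le_card_fiber_of_mul_le_card_of_maps_to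
    (s := Finset.range ((q0 + 1) * k)) (t := Finset.range (q0 + 1)) (f := α) (n := k)
    (fun i hi => Finset.mem_range.2 (Nat.lt_succ_of_le (g1 i (Finset.mem_range.1 hi)).2.2)) (by simp) (by simp)
  obtain ⟨J, hJsub, hJ⟩ := Finset.exists_subset_card_eq hac
  have hJL : ∀ i ∈ J, i < (q0 + 1) * k ∧ α i = a := fun i hi => by
    have := Finset.mem_filter.1 (hJsub hi)
    exact ⟨Finset.mem_range.1 this.1, this.2⟩
  have hB : Blocks J V s := ⟨fun i hi => (g1 i (hJL i hi).1).2.1,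
    fun i hi j hj hij => g2 i j hij (hJL j hj).1⟩
  have hVS : ∀ i ∈ J, V i ⊆ S := fun i hi => (g1 i (hJL i hi).1).1
  have haq : a ≤ q0 := Nat.lt_succ_iff.1 (Finset.mem_range.1 ha)
  have hcore := lemK_core hr hq hs0 haq hB hJ hk E S hVS A (fun i hi j hj hij v hv => by
    have := g3 i j hij (hJL j hj).1 v hv
    rw [(hJL i hi).2] at this
    exact this)
  have hlow := count_low_head hr E S η hη0.le A (fun u v h => (not_le.1 h).le)
  have hhigh := count_high_tail hr E S η hη0 hScard A (fun u v h => h) hT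
  refine ⟨J.biUnion V, Finset.biUnion_subset.2 hVS, ?_, ?_⟩
  · rw [hB.card, hJ]
    refine hs3.trans ?_
    have : s ≤ k * s := Nat.le_mul_of_pos_left s hk
    exact_mod_cast this
  · rw [hB.card, hJ]
    have hks : s ≤ k * s := Nat.le_mul_of_pos_left s hk
    have hC := pow_le_choose_mul (k * s) r (by omega)
    have hC' : ((k * s : ℕ) : ℝ) ^ r ≤ ((k * s).choose r : ℝ) * (r : ℝ) ^ r := by exact_mod_cast hC
    have hCpos : (0 : ℝ) < ((k * s).choose r : ℝ) := by
      exact_mod_cast Nat.choose_pos (by omega : r ≤ k * s)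
    set C : ℝ := ((k * s).choose r : ℝ) with hCdef
    have hn : (S.card : ℝ) ^ r ≤ G * C := by
      have e1 : (S.card : ℝ) ≤ 2 / δ * s := by
        rw [div_mul_eq_mul_div, le_div_iff₀ hδ]; linarith
      have e2 : (s : ℝ) ≤ ((k * s : ℕ) : ℝ) := by exact_mod_cast hks
      calc (S.card : ℝ) ^ r ≤ (2 / δ * ((k * s : ℕ) : ℝ)) ^ r := by
            gcongr; exact e1.trans (by gcongr)
        _ = (2 / δ) ^ r * ((k * s : ℕ) : ℝ) ^ r := mul_pow _ _ _
        _ ≤ (2 / δ) ^ r * (C * (r : ℝ) ^ r) := by gcongr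
        _ = G * C := by rw [hG]; ring
    have e1 : η * (S.card : ℝ) ^ r ≤ ε / 16 * C := by
      calc _ ≤ η * (G * C) := by gcongr
        _ = (η * G) * C := by ring
        _ ≤ _ := by gcongr
    have e2 : (r : ℝ) ^ 2 / k * ((k * s : ℕ) : ℝ) ^ r ≤ ε / 4 * C := by
      calc _ ≤ (r : ℝ) ^ 2 / k * (C * (r : ℝ) ^ r) := by gcongr
        _ = ((r : ℝ) ^ 2 / k * (r : ℝ) ^ r) * C := by ring
        _ ≤ _ := by gcongr
    have e3 : (1 / 4 + 1 / (q0 : ℝ)) * C ≤ (1 / 4 + ε / 4) * C := by gcongr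
    have e4 : 0 < ε * C := by positivity
    linarith

/-- The forbidden graph built from a linear family of tuples. -/
def FG {r : ℕ} (hr : 3 ≤ r) (N : ℕ) (𝓖 : Finset (Fin (2 * r - 2) → Fin N)) (h𝓖 : ∀ τ ∈ 𝓖, StrictMono τ) :
    RGraph r where
  verts := Finset.range N
  edges := 𝓖.image (fun τ => Finset.univ.image (fun i : Fin r => (τ (fstI hr i)).val)) ∪
    𝓖.image (fun τ => Finset.univ.image (fun i : Fin r => (τ (lstI hr i)).val))
  edges_subset := by
    intro e he
    rcases Finset.mem_union.1 he with h | h <;>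
    · obtain ⟨τ, _, rfl⟩ := Finset.mem_image.1 h
      intro v hv
      obtain ⟨i, _, rfl⟩ := Finset.mem_image.1 hv
      exact Finset.mem_range.2 (Fin.is_lt _)
  edges_card := by
    intro e he
    rcases Finset.mem_union.1 he with h | h
    · obtain ⟨τ, hτ, rfl⟩ := Finset.mem_image.1 h
      rw [Finset.card_image_of_injective, Finset.card_univ, Fintype.card_fin]
      intro i j hij
      exact (fstI_strictMono hr).injective ((h𝓖 τ hτ).injective (Fin.ext hij))
    · obtain ⟨τ, hτ, rfl⟩ := Finset.mem_image.1 h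
      rw [Finset.card_image_of_injective, Finset.card_univ, Fintype.card_fin]
      intro i j hij
      exact (lstI_strictMono hr).injective ((h𝓖 τ hτ).injective (Fin.ext hij))

theorem FG_embed {r : ℕ} (hr : 3 ≤ r) (N : ℕ) (𝓖 : Finset (Fin (2 * r - 2) → Fin N))
    (h𝓖 : ∀ τ ∈ 𝓖, StrictMono τ) (H : RGraph r) (x : Fin N → ℕ) (hx : Function.Injective x)
    (hxv : ∀ i, x i ∈ H.verts) (hT : ∀ τ ∈ 𝓖, TT hr H.edges (x ∘ τ)) : IsSubgraph (FG hr N 𝓖 h𝓖) H := by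
  refine ⟨fun v => if h : v < N then x ⟨v, h⟩ else 0, ?_, ?_, ?_⟩
  · intro u hu v hv huv
    have hu' : u < N := Finset.mem_range.1 (Finset.mem_coe.1 hu)
    have hv' : v < N := Finset.mem_range.1 (Finset.mem_coe.1 hv)
    simp only [hu', hv', dif_pos] at huv
    exact congrArg Fin.val (hx huv)
  · intro v hv
    have hv' : v < N := Finset.mem_range.1 hv
    simp only [hv', dif_pos]
    exact hxv _
  · intro e he
    rcases Finset.mem_union.1 he with h | h
    · obtain ⟨τ, hτ, rfl⟩ := Finset.mem_image.1 h
      have := (hT τ hτ).1.2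
      rw [Finset.image_image]
      convert this using 2
      funext i
      simp
    · obtain ⟨τ, hτ, rfl⟩ := Finset.mem_image.1 h
      have := (hT τ hτ).2.2
      rw [Finset.image_image]
      convert this using 2
      funext i
      simp

theorem upper {r : ℕ} (hr : 3 ≤ r) (N : ℕ) (𝓖 : Finset (Fin (2 * r - 2) → Fin N))
    (h𝓖 : ∀ τ ∈ 𝓖, StrictMono τ) (hsh : ∀ τ ∈ 𝓖, ∀ τ' ∈ 𝓖, τ ≠ τ' → ¬ Share2 τ τ')
    (ε : ℝ) (hε : 0 < ε) :
    ∃ κ : ℝ, 0 < κ ∧ ∃ n0 : ℕ, ∀ H : RGraph r, n0 ≤ H.verts.card →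
      (∀ S ⊆ H.verts, κ * H.verts.card ≤ S.card →
        (1 / 4 + ε) * (S.card.choose r : ℝ) ≤ ((H.edges.filter (fun e => e ⊆ S)).card : ℝ)) →
      IsSubgraph (FG hr N 𝓖 h𝓖) H := by
  classical
  obtain ⟨c, δ, hc, hc1, hδ, n1, HK⟩ := lemK hr ε hε
  obtain ⟨k, hk0⟩ := exists_nat_gt (2 * ((2 * r - 2 : ℕ) : ℝ) ^ 2 / c)
  have hk' : (0 : ℝ) < k := lt_of_le_of_lt (by positivity) hk0
  have hk : 0 < k := by exact_mod_cast hk'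
  have hkc : ((2 * r - 2 : ℕ) : ℝ) ^ 2 / k ≤ c / 2 := by
    rw [div_lt_iff₀ hc] at hk0
    rw [div_le_div_iff₀ hk' (by norm_num)]; linarith
  obtain ⟨K, hK⟩ := ramsey (2 * r - 2) N k
  set g := 𝓖.card with hg
  have hg0 : (0 : ℝ) ≤ g := Nat.cast_nonneg _
  set θ : ℝ → ℝ := fun c => c ^ g / (2 * g + 2) with hθ
  have hθ0 : ∀ c, 0 < c → 0 < θ c := fun c hc => by simp only [hθ]; positivity
  have hθ1 : ∀ c, 0 < c → c ≤ 1 → θ c ≤ 1 := fun c hc hc1 => by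
    simp only [hθ]
    rw [div_le_one (by positivity)]
    have : c ^ g ≤ 1 := pow_le_one₀ hc.le hc1
    linarith
  set 𝓤 : Finset (Fin (2 * r - 2) → ℕ) := (Fintype.piFinset (fun _ : Fin (2 * r - 2) => Finset.range K)).filter StrictMono with h𝓤
  obtain ⟨ξ, hξ, hξ1, HR⟩ := robust_exists (m := 2 * r - 2) θ hθ0 hθ1 (c / 2) (by positivity) (by linarith) 𝓤.card
  obtain ⟨δP, hδP, hδP1, HP⟩ := block_process 1 K
  set ρ : ℝ := ξ * (δP / 2) with hρ
  have hρ0 : 0 < ρ := by positivity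
  obtain ⟨n0, hn0⟩ := exists_nat_gt ((n1 + 1) / ρ + 2 / δP)
  refine ⟨δ * ρ, by positivity, n0, fun H hHn hD => ?_⟩
  set n := H.verts.card with hn
  have hnn : (n1 + 1) / ρ + 2 / δP < (n : ℝ) := hn0.trans_le (by exact_mod_cast hHn)
  have hn1 : (n1 + 1 : ℝ) < ρ * n := by
    have : (n1 + 1) / ρ < (n : ℝ) := lt_of_le_of_lt (by
      have : 0 < 2 / δP := by positivity
      linarith) hnn
    rw [div_lt_iff₀ hρ0] at this; linarith
  have hn2 : 2 < δP * n := by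
    have : 2 / δP < (n : ℝ) := lt_of_le_of_lt (by
      have : 0 < (n1 + 1 : ℝ) / ρ := by positivity
      linarith) hnn
    rw [div_lt_iff₀ hδP] at this; linarith
  set s := ⌊δP * (n : ℝ)⌋₊ with hs
  have hs1 : (s : ℝ) ≤ δP * n := Nat.floor_le (by positivity)
  have hs2 : δP * n < s + 1 := Nat.lt_floor_add_one _
  have hs3 : δP / 2 * n ≤ s := by linarith
  have hs0 : 0 < s := by
    have : (0 : ℝ) < s := by linarith
    exact_mod_cast this
  obtain ⟨V, α, g1, g2, -⟩ := HP (fun _ _ => False) H.verts s hs0 hs1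
  set W : ℕ → Finset ℕ := fun i => if i < K then V i else Finset.range s with hW
  have hWlt : ∀ i, i < K → W i = V i := fun i hi => by simp [hW, hi]
  have hWc : ∀ i, (W i).card = s := by
    intro i
    by_cases hi : i < K
    · rw [hWlt i hi]; exact (g1 i hi).2.1
    · simp [hW, hi]
  obtain ⟨V', s', c1, 𝓑, f1, f2, f3, f4, f5, f6, f7⟩ := HR (TT hr H.edges) 𝓤 rfl
    (fun t ht => (Finset.mem_filter.1 ht).2.injective) W s hWc
  have hs' : ρ * n ≤ s' := by
    calc ρ * n = ξ * (δP / 2 * n) := by rw [hρ]; ring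
      _ ≤ ξ * s := by gcongr
      _ ≤ s' := f3
  have hs'1 : n1 < s' := by
    have : (n1 : ℝ) < s' := by linarith
    exact_mod_cast this
  have hs'0 : 0 < s' := by omega
  have hVH : ∀ i, i < K → V' i ⊆ H.verts := fun i hi => by
    have := f1 i
    rw [hWlt i hi] at this
    exact this.trans (g1 i hi).1
  have hBl : Blocks (Finset.range K) V' s' := by
    refine ⟨fun i _ => f2 i, fun i hi j hj hij u hu v hv => ?_⟩
    have hi' := Finset.mem_range.1 hi
    have hj' := Finset.mem_range.1 hj
    have a1 := f1 i hu
    have a2 := f1 j hv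
    rw [hWlt i hi'] at a1
    rw [hWlt j hj'] at a2
    exact g2 i j hij hj' u a1 v a2
  have hram := hK (Finset.range K) (by simp) (fun B => ∀ t ∈ 𝓤, Finset.univ.image t = B → t ∉ 𝓑)
  rcases hram with ⟨A, hAK, hAc, hcol⟩ | ⟨A, hAK, hAc, hcol⟩
  · -- good case
    set σ := A.orderEmbOfFin hAc with hσ
    have hσA : ∀ i, σ i ∈ A := fun i => Finset.orderEmbOfFin_mem A hAc i
    have hσK : ∀ i, σ i < K := fun i => Finset.mem_range.1 (hAK (hσA i))
    have hrob : ∀ τ ∈ 𝓖, Robust (TT hr H.edges) (fun i => V' (σ (τ i))) (θ c1) c1 := by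
      intro τ hτ
      have hsm : StrictMono (fun i => σ (τ i)) := fun i j hij => σ.strictMono (h𝓖 τ hτ hij)
      have hmem : (fun i => σ (τ i)) ∈ 𝓤 := Finset.mem_filter.2
        ⟨Fintype.mem_piFinset.2 fun i => hAK (hσA _), hsm⟩
      refine f7 _ hmem (hcol (Finset.univ.image (fun i => σ (τ i))) ?_ ?_ _ hmem rfl)
      · intro v hv
        obtain ⟨i, _, rfl⟩ := Finset.mem_image.1 hv
        exact hσA _
      · rw [Finset.card_image_of_injective _ hsm.injective, Finset.card_univ, Fintype.card_fin]
    have hpos := hom_pos (TT hr H.edges) (fun i => V' (σ i)) (fun i => f2 _) hs'0 (θ c1) c1 (hθ0 c1 f4).le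
      f4.le f5 𝓖 (fun τ hτ => (h𝓖 τ hτ).injective) hsh hrob
    have hlow : 0 < (c1 ^ 𝓖.card - 𝓖.card * θ c1) * (s' : ℝ) ^ N := by
      have hs'' : (0 : ℝ) < s' := by exact_mod_cast hs'0
      apply mul_pos _ (by positivity)
      have e1 : c1 ^ 𝓖.card - 𝓖.card * θ c1 = c1 ^ g * ((g + 2) / (2 * g + 2)) := by
        simp only [hθ, ← hg]
        field_simp
        ring
      rw [e1]
      positivity
    have hcp := lt_of_lt_of_le hlow hpos
    have hcp' : 0 < cnt (fun x : Fin N → ℕ => ∀ τ' ∈ 𝓖, TT hr H.edges (x ∘ τ')) (fun i => V' (σ i)) := by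
      exact_mod_cast hcp
    rw [cnt_eq, Finset.card_pos] at hcp'
    obtain ⟨x, hx⟩ := hcp'
    obtain ⟨hx1, hx2⟩ := Finset.mem_filter.1 hx
    rw [Fintype.mem_piFinset] at hx1
    refine FG_embed hr N 𝓖 h𝓖 H x ?_ (fun i => hVH _ (hσK i) (hx1 i)) hx2
    intro i j hij
    have h1 := hx1 i
    have h2 := hx1 j
    rw [← hij] at h2
    exact σ.injective (hBl.unique (hAK (hσA i)) (hAK (hσA j)) h1 h2)
  · -- bad case
    exfalso
    have hBA := hBl.mono hAK
    set S := A.biUnion V' with hS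
    have hSc : S.card = k * s' := by rw [hS, hBA.card, hAc]
    have hSH : S ⊆ H.verts := Finset.biUnion_subset.2 fun i hi => hVH i (Finset.mem_range.1 (hAK hi))
    have hbc := block_count (m := 2 * r - 2) hBA hs'0 (by omega) (TT hr H.edges)
    have heq : cnt (TT hr H.edges) (fun _ => S) = cnt (fun w => StrictMono w ∧ TT hr H.edges w) (fun _ => S) := by
      congr 1
      funext w
      exact propext ⟨fun h => ⟨h.strictMono, h⟩, fun h => h.2⟩
    have hsm : ∑ t ∈ (Fintype.piFinset (fun _ : Fin (2 * r - 2) => A)).filter StrictMono,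
        (cnt (TT hr H.edges) (fun i => V' (t i)) : ℝ) ≤ c / 2 * ((k * s' : ℕ) : ℝ) ^ (2 * r - 2) := by
      have hter : ∀ t ∈ (Fintype.piFinset (fun _ : Fin (2 * r - 2) => A)).filter StrictMono,
          (cnt (TT hr H.edges) (fun i => V' (t i)) : ℝ) ≤ c / 2 * (s' : ℝ) ^ (2 * r - 2) := by
        intro t ht
        obtain ⟨ht1, ht2⟩ := Finset.mem_filter.1 ht
        rw [Fintype.mem_piFinset] at ht1
        have hno := hcol (Finset.univ.image t) (by
          intro v hv
          obtain ⟨i, _, rfl⟩ := Finset.mem_image.1 hv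
          exact ht1 i) (by
          rw [Finset.card_image_of_injective _ ht2.injective, Finset.card_univ, Fintype.card_fin])
        push Not at hno
        obtain ⟨t', ht'U, him, ht'B⟩ := hno
        have : t' = t := image_strictMono_inj (Finset.mem_filter.1 ht'U).2 ht2 him
        subst this
        exact f6 t' ht'U ht'B
      refine (Finset.sum_le_sum hter).trans ?_
      rw [Finset.sum_const, nsmul_eq_mul]
      have hcard : (((Fintype.piFinset (fun _ : Fin (2 * r - 2) => A)).filter StrictMono).card : ℝ) ≤ (k : ℝ) ^ (2 * r - 2) := by
        have := Finset.card_filter_le (Fintype.piFinset (fun _ : Fin (2 * r - 2) => A)) StrictMono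
        rw [Fintype.card_piFinset] at this
        simp only [hAc, Finset.prod_const, Finset.card_univ, Fintype.card_fin] at this
        exact_mod_cast this
      calc _ ≤ (k : ℝ) ^ (2 * r - 2) * (c / 2 * (s' : ℝ) ^ (2 * r - 2)) := by gcongr
        _ = _ := by push_cast; ring
    have hT : (cnt (TT hr H.edges) (fun _ => S) : ℝ) ≤ c * (S.card : ℝ) ^ (2 * r - 2) := by
      rw [heq, hSc]
      rw [hAc] at hbc
      refine hbc.trans ?_
      have : ((2 * r - 2 : ℕ) : ℝ) ^ 2 / k * ((k * s' : ℕ) : ℝ) ^ (2 * r - 2) ≤ c / 2 * ((k * s' : ℕ) : ℝ) ^ (2 * r - 2) := by gcongr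
      linarith
    have hks : s' ≤ k * s' := Nat.le_mul_of_pos_left s' hk
    obtain ⟨S', hS'S, hS'c, hS'e⟩ := HK H.edges S (by rw [hSc]; omega) hT
    have hd := hD S' (hS'S.trans hSH) (by
      refine le_trans ?_ hS'c
      rw [mul_assoc, hSc]
      have : (s' : ℝ) ≤ ((k * s' : ℕ) : ℝ) := by exact_mod_cast hks
      gcongr
      linarith)
    have hset : H.edges.filter (fun e => e ⊆ S') ⊆ (Finset.powersetCard r S').filter (fun e => e ∈ H.edges) := by
      intro e he
      obtain ⟨h1, h2⟩ := Finset.mem_filter.1 he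
      exact Finset.mem_filter.2 ⟨Finset.mem_powersetCard.2 ⟨h2, H.edges_card e h1⟩, h1⟩
    have hle : ((H.edges.filter (fun e => e ⊆ S')).card : ℝ) ≤
        (((Finset.powersetCard r S').filter (fun e => e ∈ H.edges)).card : ℝ) := by
      exact_mod_cast Finset.card_le_card hset
    have hSedge : (((Finset.powersetCard r S').filter (fun e => e ∈ H.edges)).card : ℝ) <
        (1 / 4 + ε) * (S'.card.choose r : ℝ) := by
      convert hS'e
    linarith

theorem sum_range_blocks (L D : ℕ) (F : ℕ → ℝ) :
    ∑ v ∈ Finset.range (L * D), F v = ∑ b ∈ Finset.range L, ∑ y ∈ Finset.range D, F (b * D + y) := by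
  induction L with
  | zero => simp
  | succ L ih => rw [Nat.succ_mul, Finset.sum_range_add, ih, Finset.sum_range_succ]

/-- Sylvester type sign matrix. -/
def Md : ℕ → ℕ → ℕ → ℝ
  | 0, _, _ => 1
  | d + 1, x, y => Md d (x / 2) (y / 2) * (if x % 2 = 1 ∧ y % 2 = 1 then -1 else 1)

theorem Md_symm (d : ℕ) : ∀ x y, Md d x y = Md d y x := by
  induction d with
  | zero => intro x y; rfl
  | succ d ih =>
    intro x y
    simp only [Md]
    rw [ih (x / 2) (y / 2)]
    simp only [and_comm]

theorem Md_val (d : ℕ) : ∀ x y, Md d x y = 1 ∨ Md d x y = -1 := by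
  induction d with
  | zero => intro x y; left; rfl
  | succ d ih =>
    intro x y
    simp only [Md]
    rcases ih (x / 2) (y / 2) with h | h <;> rw [h] <;> split_ifs <;> simp

theorem Md_sq (d x y : ℕ) : Md d x y * Md d x y = 1 := by
  rcases Md_val d x y with h | h <;> rw [h] <;> norm_num

theorem Md_orth (d : ℕ) : ∀ x x', x < 2 ^ d → x' < 2 ^ d → x ≠ x' →
    ∑ y ∈ Finset.range (2 ^ d), Md d x y * Md d x' y = 0 := by
  induction d with
  | zero => intro x x' hx hx' hne; simp at hx hx'; omega
  | succ d ih =>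
    intro x x' hx hx' hne
    rw [pow_succ] at hx hx'
    rw [pow_succ, sum_range_blocks]
    have hd : ∀ b, (b * 2 + 1) / 2 = b := fun b => by omega
    have hd0 : ∀ b, (b * 2) / 2 = b := fun b => by omega
    have hm : ∀ b, (b * 2 + 1) % 2 = 1 := fun b => by omega
    have hm0 : ∀ b, (b * 2) % 2 = 0 := fun b => by omega
    have hterm : ∀ b, ∑ y ∈ Finset.range 2, Md (d + 1) x (b * 2 + y) * Md (d + 1) x' (b * 2 + y) =
        (Md d (x / 2) b * Md d (x' / 2) b) *
          (1 + (if x % 2 = 1 then -1 else 1) * (if x' % 2 = 1 then -1 else 1)) := by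
      intro b
      rw [Finset.sum_range_succ, Finset.sum_range_one]
      simp only [Md, add_zero, hd, hd0, hm, hm0, and_true, zero_ne_one, and_false, if_false]
      ring
    rw [Finset.sum_congr rfl (fun b _ => hterm b), ← Finset.sum_mul]
    by_cases h : x / 2 = x' / 2
    · have : x % 2 ≠ x' % 2 := by omega
      have h1 : (1 : ℝ) + (if x % 2 = 1 then -1 else 1) * (if x' % 2 = 1 then -1 else 1) = 0 := by
        rcases Nat.mod_two_eq_zero_or_one x with a | a <;> rcases Nat.mod_two_eq_zero_or_one x' with b | b <;>
          simp [a, b] at this ⊢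
      rw [h1, mul_zero]
    · rw [ih (x / 2) (x' / 2) (by omega) (by omega) h, zero_mul]

theorem corr {d L P : ℕ} (hP : 2 ^ d = P ^ 2) (Q : Finset ℕ) (hQ : Q ⊆ Finset.range (L * 2 ^ d)) :
    ∑ y ∈ Finset.range (2 ^ d), |∑ u ∈ Q, Md d (u % 2 ^ d) y| ≤ (L : ℝ) * (P : ℝ) ^ 3 := by
  classical
  set D := 2 ^ d with hD
  have hDpos : 0 < D := by rw [hD]; positivity
  have hclass : ∀ x, (Q.filter (fun u' => u' % D = x)).card ≤ L := by
    intro x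
    rw [← Finset.card_range L]
    apply Finset.card_le_card_of_injOn (fun u => u / D)
    · intro u hu
      have h1 := (Finset.mem_filter.1 (Finset.mem_coe.1 hu)).1
      have h2 := Finset.mem_range.1 (hQ h1)
      rw [Finset.mem_coe, Finset.mem_range]
      exact Nat.div_lt_of_lt_mul (by rw [mul_comm]; exact h2)
    · intro u hu u' hu' h
      have h1 := (Finset.mem_filter.1 (Finset.mem_coe.1 hu)).2
      have h2 := (Finset.mem_filter.1 (Finset.mem_coe.1 hu')).2
      simp only at h
      rw [← Nat.div_add_mod u D, ← Nat.div_add_mod u' D, h, h1, h2]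
  have hQc : Q.card ≤ L * D := by
    have := Finset.card_le_card hQ
    rwa [Finset.card_range] at this
  have hsq : ∑ y ∈ Finset.range D, (∑ u ∈ Q, Md d (u % D) y) ^ 2 ≤ (L * D : ℝ) * (L * D) := by
    have e1 : ∑ y ∈ Finset.range D, (∑ u ∈ Q, Md d (u % D) y) ^ 2 =
        ∑ u ∈ Q, ∑ u' ∈ Q, ∑ y ∈ Finset.range D, Md d (u % D) y * Md d (u' % D) y := by
      simp_rw [sq, Finset.sum_mul_sum]
      rw [Finset.sum_comm]
      apply Finset.sum_congr rfl
      intro u _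
      rw [Finset.sum_comm]
    have e2 : ∀ u ∈ Q, ∑ u' ∈ Q, ∑ y ∈ Finset.range D, Md d (u % D) y * Md d (u' % D) y ≤ (L * D : ℝ) := by
      intro u _
      have e3 : ∀ u' ∈ Q, ∑ y ∈ Finset.range D, Md d (u % D) y * Md d (u' % D) y =
          if u' % D = u % D then (D : ℝ) else 0 := by
        intro u' _
        split_ifs with h
        · rw [h]
          simp [Md_sq]
        · exact Md_orth d _ _ (Nat.mod_lt _ hDpos) (Nat.mod_lt _ hDpos) (fun h' => h h'.symm)
      rw [Finset.sum_congr rfl e3, ← Finset.sum_filter, Finset.sum_const, nsmul_eq_mul]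
      have : ((Q.filter (fun u' => u' % D = u % D)).card : ℝ) ≤ L := by exact_mod_cast hclass _
      gcongr
    rw [e1]
    refine (Finset.sum_le_sum e2).trans ?_
    rw [Finset.sum_const, nsmul_eq_mul]
    have : (Q.card : ℝ) ≤ L * D := by exact_mod_cast hQc
    gcongr
  have hcs := sq_sum_le_card_mul_sum_sq (s := Finset.range D) (f := fun y => |∑ u ∈ Q, Md d (u % D) y|)
  simp only [sq_abs, Finset.card_range] at hcs
  have hDP : (D : ℝ) = (P : ℝ) ^ 2 := by exact_mod_cast hP
  apply le_of_sq_le_sq _ (by positivity)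
  calc _ ≤ (D : ℝ) * ((L * D : ℝ) * (L * D)) := hcs.trans (by gcongr)
    _ = _ := by rw [hDP]; ring

noncomputable def chi (d : ℕ) (u v : ℕ) : ℝ :=
  if u / 2 ^ d = v / 2 ^ d then 0 else Md d (u % 2 ^ d) (v % 2 ^ d)

theorem chi_symm (d u v : ℕ) : chi d u v = chi d v u := by
  unfold chi
  by_cases h : u / 2 ^ d = v / 2 ^ d
  · rw [if_pos h, if_pos h.symm]
  · rw [if_neg h, if_neg (fun h' => h h'.symm), Md_symm]

theorem chi_val (d u v : ℕ) : chi d u v = 0 ∨ chi d u v = 1 ∨ chi d u v = -1 := by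
  unfold chi
  split_ifs
  · left; rfl
  · right; exact Md_val _ _ _

theorem chi_row {d L P : ℕ} (hP : 2 ^ d = P ^ 2) (S : Finset ℕ) (hS : S ⊆ Finset.range (L * 2 ^ d))
    (R : ℕ → ℕ → Prop) [∀ v, DecidablePred (fun u => R u v)]
    (Q : ℕ → Finset ℕ) (hQS : ∀ b, Q b ⊆ S)
    (hQ : ∀ b u y, y < 2 ^ d → u ∈ S → u / 2 ^ d ≠ b → (R u (b * 2 ^ d + y) ↔ u ∈ Q b))
    (hQ' : ∀ b, ∀ u ∈ Q b, u / 2 ^ d ≠ b) :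
    ∑ v ∈ Finset.range (L * 2 ^ d), |∑ u ∈ S.filter (fun u => R u v), chi d u v| ≤
      (L : ℝ) * (L * (P : ℝ) ^ 3) := by
  classical
  have hDpos : 0 < 2 ^ d := by positivity
  rw [sum_range_blocks]
  have : ∀ b ∈ Finset.range L, ∑ y ∈ Finset.range (2 ^ d),
      |∑ u ∈ S.filter (fun u => R u (b * 2 ^ d + y)), chi d u (b * 2 ^ d + y)| ≤ (L * (P : ℝ) ^ 3) := by
    intro b _
    refine le_trans (le_of_eq ?_) (corr hP (Q b) ((hQS b).trans hS))
    apply Finset.sum_congr rfl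
    intro y hy
    have hy' := Finset.mem_range.1 hy
    have hdiv : (b * 2 ^ d + y) / 2 ^ d = b := by
      rw [mul_comm, Nat.mul_add_div hDpos, Nat.div_eq_of_lt hy', add_zero]
    have hmod : (b * 2 ^ d + y) % 2 ^ d = y := by
      rw [mul_comm, Nat.mul_add_mod, Nat.mod_eq_of_lt hy']
    congr 1
    have e1 : ∑ u ∈ Q b, Md d (u % 2 ^ d) y = ∑ u ∈ Q b, chi d u (b * 2 ^ d + y) := by
      apply Finset.sum_congr rfl
      intro u hu
      rw [chi, hdiv, hmod, if_neg (hQ' b u hu)]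
    rw [e1]
    symm
    apply Finset.sum_subset
    · intro u hu
      exact Finset.mem_filter.2 ⟨hQS b hu, (hQ b u y hy' (hQS b hu) (hQ' b u hu)).2 hu⟩
    · intro u hu hu'
      obtain ⟨h1, h2⟩ := Finset.mem_filter.1 hu
      by_cases hb : u / 2 ^ d = b
      · rw [chi, hdiv, if_pos hb]
      · exact absurd ((hQ b u y hy' h1 hb).1 h2) hu'
  refine (Finset.sum_le_sum this).trans ?_
  simp

theorem chi_lt {d L P : ℕ} (hP : 2 ^ d = P ^ 2) (S : Finset ℕ) (hS : S ⊆ Finset.range (L * 2 ^ d)) :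
    ∑ v ∈ Finset.range (L * 2 ^ d), |∑ u ∈ S.filter (fun u => u < v), chi d u v| ≤
      (L : ℝ) * (L * (P : ℝ) ^ 3) := by
  have hDpos : 0 < 2 ^ d := by positivity
  refine chi_row hP S hS (fun u v => u < v) (fun b => S.filter (fun u => u / 2 ^ d < b))
    (fun b => Finset.filter_subset _ _) ?_ ?_
  · intro b u y hy hu hb
    simp only [Finset.mem_filter, hu, true_and]
    have h1 := Nat.div_add_mod u (2 ^ d)
    have h2 := Nat.mod_lt u hDpos
    rw [mul_comm] at h1
    constructor
    · intro h
      by_contra hcon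
      have : b + 1 ≤ u / 2 ^ d := by omega
      have := Nat.mul_le_mul_right (2 ^ d) this
      rw [Nat.add_mul] at this
      omega
    · intro h
      have := Nat.mul_le_mul_right (2 ^ d) (Nat.succ_le_of_lt h)
      rw [Nat.succ_mul] at this
      omega
  · intro b u hu
    exact (Finset.mem_filter.1 hu).2.ne

theorem chi_gt {d L P : ℕ} (hP : 2 ^ d = P ^ 2) (S : Finset ℕ) (hS : S ⊆ Finset.range (L * 2 ^ d)) :
    ∑ v ∈ Finset.range (L * 2 ^ d), |∑ u ∈ S.filter (fun u => v < u), chi d u v| ≤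
      (L : ℝ) * (L * (P : ℝ) ^ 3) := by
  have hDpos : 0 < 2 ^ d := by positivity
  refine chi_row hP S hS (fun u v => v < u) (fun b => S.filter (fun u => b < u / 2 ^ d))
    (fun b => Finset.filter_subset _ _) ?_ ?_
  · intro b u y hy hu hb
    simp only [Finset.mem_filter, hu, true_and]
    have h1 := Nat.div_add_mod u (2 ^ d)
    have h2 := Nat.mod_lt u hDpos
    rw [mul_comm] at h1
    constructor
    · intro h
      by_contra hcon
      have : u / 2 ^ d + 1 ≤ b := by omega
      have := Nat.mul_le_mul_right (2 ^ d) this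
      rw [Nat.add_mul] at this
      omega
    · intro h
      have := Nat.mul_le_mul_right (2 ^ d) (Nat.succ_le_of_lt h)
      rw [Nat.succ_mul] at this
      omega
  · intro b u hu
    exact (Finset.mem_filter.1 hu).2.ne'

open Classical in
theorem chi_zero (d L : ℕ) :
    ∑ u ∈ Finset.range (L * 2 ^ d), ∑ v ∈ Finset.range (L * 2 ^ d), (if chi d u v = 0 then (1 : ℝ) else 0) ≤
      (L : ℝ) * 2 ^ d * 2 ^ d := by
  have hDpos : 0 < 2 ^ d := by positivity
  have : ∀ u ∈ Finset.range (L * 2 ^ d),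
      ∑ v ∈ Finset.range (L * 2 ^ d), (if chi d u v = 0 then (1 : ℝ) else 0) ≤ (2 ^ d : ℝ) := by
    intro u _
    rw [sum_ind_eq_card]
    have : ((Finset.range (L * 2 ^ d)).filter (fun v => chi d u v = 0)).card ≤ (Finset.range (2 ^ d)).card := by
      apply Finset.card_le_card_of_injOn (fun v => v % 2 ^ d)
      · intro v _
        rw [Finset.mem_coe, Finset.mem_range]
        exact Nat.mod_lt _ hDpos
      · have key : ∀ v ∈ (Finset.range (L * 2 ^ d)).filter (fun v => chi d u v = 0), u / 2 ^ d = v / 2 ^ d := by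
          intro v hv
          have := (Finset.mem_filter.1 hv).2
          unfold chi at this
          by_contra hne
          rw [if_neg hne] at this
          rcases Md_val d (u % 2 ^ d) (v % 2 ^ d) with h | h <;> rw [h] at this <;> norm_num at this
        intro v hv v' hv' h
        simp only at h
        have h1 := key v (Finset.mem_coe.1 hv)
        have h2 := key v' (Finset.mem_coe.1 hv')
        rw [← Nat.div_add_mod v (2 ^ d), ← Nat.div_add_mod v' (2 ^ d), ← h1, ← h2, h]
    rw [Finset.card_range] at this
    exact_mod_cast this
  refine (Finset.sum_le_sum this).trans ?_
  simp

theorem err_bound {r : ℕ} (hr : 3 ≤ r) (S : Finset ℕ) (p p' : Fin r) (g : (Fin r → ℕ) → ℝ) (f : ℕ → ℝ)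
    (n : ℕ) (B : ℝ) (hsn : S.card ≤ n)
    (h : ∀ x : Fin r → ℕ, |∑ y ∈ S, g (Function.update x p y)| ≤ f (x p'))
    (hf : ∑ v ∈ S, f v ≤ B) (hf0 : ∀ v, 0 ≤ f v) :
    |∑ x ∈ Fintype.piFinset (fun _ : Fin r => S), g x| ≤ (n : ℝ) ^ (r - 2) * B := by
  have hB : 0 ≤ B := (Finset.sum_nonneg (fun v _ => hf0 v)).trans hf
  rcases Nat.eq_zero_or_pos S.card with h0 | hpos
  · have hS : S = ∅ := Finset.card_eq_zero.1 h0
    have : Fintype.piFinset (fun _ : Fin r => S) = ∅ := by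
      rw [Finset.eq_empty_iff_forall_notMem]
      intro x hx
      have := Fintype.mem_piFinset.1 hx ⟨0, by omega⟩
      rw [hS] at this
      simp at this
    rw [this]
    simp only [Finset.sum_empty, abs_zero]
    positivity
  have hs : (0 : ℝ) < S.card := by exact_mod_cast hpos
  have e1 := resample_one (fun _ : Fin r => S) p g
  have e2 := resample_one (fun _ : Fin r => S) p' (fun x => f (x p'))
  simp only [Function.update_self, Finset.sum_const, nsmul_eq_mul, Fintype.card_piFinset_const] at e2
  have e3 : (S.card : ℝ) * |∑ x ∈ Fintype.piFinset (fun _ : Fin r => S), g x| ≤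
      ∑ x ∈ Fintype.piFinset (fun _ : Fin r => S), f (x p') := by
    rw [← abs_of_pos hs, ← abs_mul, ← e1]
    exact (Finset.abs_sum_le_sum_abs _ _).trans (Finset.sum_le_sum fun x _ => h x)
  have e4 : (S.card : ℝ) * ((S.card : ℝ) * |∑ x ∈ Fintype.piFinset (fun _ : Fin r => S), g x|) ≤
      (S.card : ℝ) * ((S.card : ℝ) * ((S.card : ℝ) ^ (r - 2) * B)) := by
    calc _ ≤ (S.card : ℝ) * ∑ x ∈ Fintype.piFinset (fun _ : Fin r => S), f (x p') := by gcongr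
      _ = ((S.card ^ r : ℕ) : ℝ) * ∑ v ∈ S, f v := e2.symm
      _ ≤ ((S.card ^ r : ℕ) : ℝ) * B := by gcongr
      _ = _ := by
        obtain ⟨k, rfl⟩ : ∃ k, r = k + 2 := ⟨r - 2, by omega⟩
        push_cast
        ring
  have e5 := le_of_mul_le_mul_left (le_of_mul_le_mul_left e4 hs) hs
  refine e5.trans ?_
  have : (S.card : ℝ) ≤ n := by exact_mod_cast hsn
  gcongr

theorem sm_update_first {r : ℕ} (hr : 3 ≤ r) (x : Fin r → ℕ) (y : ℕ) :
    StrictMono (Function.update x ⟨0, by omega⟩ y) ↔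
      (∀ i j : Fin r, 0 < i.1 → i < j → x i < x j) ∧ y < x ⟨1, by omega⟩ := by
  have hne : ∀ i : Fin r, 0 < i.1 → Function.update x ⟨0, by omega⟩ y i = x i := by
    intro i hi
    apply Function.update_of_ne
    intro h
    rw [h] at hi
    simp at hi
  constructor
  · intro h
    refine ⟨fun i j hi hij => ?_, ?_⟩
    · have hij' : i.1 < j.1 := hij
      have := h hij
      rwa [hne i hi, hne j (by omega)] at this
    · have := h (show (⟨0, by omega⟩ : Fin r) < ⟨1, by omega⟩ from Nat.zero_lt_one)
      rwa [Function.update_self, hne _ Nat.zero_lt_one] at this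
  · rintro ⟨h1, h2⟩ i j hij
    have hij' : i.1 < j.1 := hij
    rw [hne j (by omega)]
    by_cases hi : 0 < i.1
    · rw [hne i hi]
      exact h1 i j hi hij
    · have hi0 : i = ⟨0, by omega⟩ := Fin.ext (by simp; omega)
      rw [hi0, Function.update_self]
      by_cases hj : j.1 = 1
      · have : j = ⟨1, by omega⟩ := Fin.ext hj
        rw [this]; exact h2
      · exact h2.trans (h1 _ _ Nat.zero_lt_one (show 1 < j.1 by omega))

theorem sm_update_last {r : ℕ} (hr : 3 ≤ r) (x : Fin r → ℕ) (y : ℕ) :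
    StrictMono (Function.update x ⟨r - 1, by omega⟩ y) ↔
      (∀ i j : Fin r, j.1 < r - 1 → i < j → x i < x j) ∧ x ⟨r - 2, by omega⟩ < y := by
  have hne : ∀ i : Fin r, i.1 < r - 1 → Function.update x ⟨r - 1, by omega⟩ y i = x i := by
    intro i hi
    apply Function.update_of_ne
    intro h
    rw [h] at hi
    simp at hi
  constructor
  · intro h
    refine ⟨fun i j hj hij => ?_, ?_⟩
    · have hij' : i.1 < j.1 := hij
      have := h hij
      rwa [hne i (by omega), hne j hj] at this
    · have := h (show (⟨r - 2, by omega⟩ : Fin r) < ⟨r - 1, by omega⟩ from (by show r - 2 < r - 1; omega))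
      rwa [Function.update_self, hne _ (by show r - 2 < r - 1; omega)] at this
  · rintro ⟨h1, h2⟩ i j hij
    have hij' : i.1 < j.1 := hij
    have hjr := j.2
    rw [hne i (by omega)]
    by_cases hj : j.1 < r - 1
    · rw [hne j hj]
      exact h1 i j hj hij
    · have hj0 : j = ⟨r - 1, by omega⟩ := Fin.ext (by simp; omega)
      rw [hj0, Function.update_self]
      by_cases hi : i.1 = r - 2
      · have : i = ⟨r - 2, by omega⟩ := Fin.ext hi
        rw [this]; exact h2
      · exact (h1 i ⟨r - 2, by omega⟩ (by show r - 2 < r - 1; omega) (show i.1 < r - 2 by omega)).trans h2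

/-- Good tuples: increasing, red head, blue tail. -/
def Good {r : ℕ} (hr : 3 ≤ r) (d : ℕ) (w : Fin r → ℕ) : Prop :=
  StrictMono w ∧ chi d (w ⟨0, by omega⟩) (w ⟨1, by omega⟩) = 1 ∧
    chi d (w ⟨r - 2, by omega⟩) (w ⟨r - 1, by omega⟩) = -1

open Classical in
theorem count_good {r : ℕ} (hr : 3 ≤ r) {d L P : ℕ} (hP : 2 ^ d = P ^ 2) (hL : L = P) (S : Finset ℕ)
    (hS : S ⊆ Finset.range (L * 2 ^ d)) :
    (1 / 4) * (S.card.choose r : ℝ) - 2 * (((L * 2 ^ d : ℕ) : ℝ) ^ (r - 2) * (P : ℝ) ^ 5) ≤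
      (((Fintype.piFinset (fun _ : Fin r => S)).filter (Good hr d)).card : ℝ) := by
  have hsn : S.card ≤ L * 2 ^ d := by
    have := Finset.card_le_card hS
    rwa [Finset.card_range] at this
  set n := L * 2 ^ d with hn
  have hDP : (2 : ℝ) ^ d = (P : ℝ) ^ 2 := by exact_mod_cast hP
  have hLP : (L : ℝ) = P := by rw [hL]
  let i0 : Fin r := ⟨0, by omega⟩
  let i1 : Fin r := ⟨1, by omega⟩
  let j0 : Fin r := ⟨r - 2, by omega⟩
  let j1 : Fin r := ⟨r - 1, by omega⟩
  have hi1 : i1 ≠ i0 := fun h => by have := congrArg Fin.val h; simp [i0, i1] at this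
  have hj0 : j0 ≠ i0 := fun h => by have := congrArg Fin.val h; simp [i0, j0] at this; omega
  have hj1 : j1 ≠ i0 := fun h => by have := congrArg Fin.val h; simp [i0, j1] at this; omega
  have hj01 : j0 ≠ j1 := fun h => by have := congrArg Fin.val h; simp [j0, j1] at this; omega
  have hi0j : i0 ≠ j1 := hj1.symm
  have hi1j : i1 ≠ j1 := fun h => by have := congrArg Fin.val h; simp [i1, j1] at this; omega
  let M : (Fin r → ℕ) → ℝ := fun x => if StrictMono x then 1 else 0
  let z : ℕ → ℕ → ℝ := fun u v => if chi d u v = 0 then 1 else 0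
  have hz0 : ∀ u v, 0 ≤ z u v := fun u v => by simp only [z]; split_ifs <;> norm_num
  have hzsum : ∑ v ∈ S, ∑ u ∈ S, z u v ≤ (P : ℝ) ^ 5 := by
    rw [Finset.sum_comm]
    refine le_trans ?_ ((chi_zero d L).trans (le_of_eq ?_))
    · refine (Finset.sum_le_sum_of_subset_of_nonneg hS (fun u _ _ => Finset.sum_nonneg fun v _ => hz0 u v)).trans ?_
      exact Finset.sum_le_sum fun u _ => Finset.sum_le_sum_of_subset_of_nonneg hS (fun v _ _ => hz0 u v)
    · rw [hDP, hLP]; ring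
  have hzb : ∀ a b : Fin r, b ≠ a → |∑ x ∈ Fintype.piFinset (fun _ : Fin r => S), z (x a) (x b)| ≤
      (n : ℝ) ^ (r - 2) * (P : ℝ) ^ 5 := by
    intro a b hab
    refine err_bound hr S a b _ (fun v => ∑ u ∈ S, z u v) n _ hsn ?_ hzsum
      (fun v => Finset.sum_nonneg fun u _ => hz0 u v)
    intro x
    simp only [Function.update_self, Function.update_of_ne hab]
    rw [abs_of_nonneg (Finset.sum_nonneg fun u _ => hz0 _ _)]
  have hR : (L : ℝ) * (L * (P : ℝ) ^ 3) = (P : ℝ) ^ 5 := by rw [hLP]; ring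
  have hlt := (Finset.sum_le_sum_of_subset_of_nonneg hS (fun v _ _ => abs_nonneg _)).trans (chi_lt hP S hS)
  have hgt := (Finset.sum_le_sum_of_subset_of_nonneg hS (fun v _ _ => abs_nonneg _)).trans (chi_gt hP S hS)
  rw [hR] at hlt hgt
  have b1 : |∑ x ∈ Fintype.piFinset (fun _ : Fin r => S), M x * (chi d (x i0) (x i1) *
      (chi d (x j0) (x j1) ^ 2 - chi d (x j0) (x j1)))| ≤ (n : ℝ) ^ (r - 2) * (2 * (P : ℝ) ^ 5) := by
    refine err_bound hr S i0 i1 _ (fun v => 2 * |∑ u ∈ S.filter (fun u => u < v), chi d u v|) n _ hsn ?_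
      (by rw [← Finset.mul_sum]; linarith) (fun v => by positivity)
    intro x
    simp only [Function.update_self, Function.update_of_ne hi1, Function.update_of_ne hj0,
      Function.update_of_ne hj1]
    have : ∀ y, M (Function.update x i0 y) =
        (if (∀ i j : Fin r, 0 < i.1 → i < j → x i < x j) then 1 else 0) * (if y < x i1 then 1 else 0) := by
      intro y
      simp only [M, i0, i1, sm_update_first hr x y]
      by_cases h1 : (∀ i j : Fin r, 0 < i.1 → i < j → x i < x j) <;>
        by_cases h2 : y < x ⟨1, by omega⟩ <;> simp only [h1, h2, and_true, and_false, if_true, if_false] <;> norm_num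
    simp only [this]
    set c : ℝ := (if (∀ i j : Fin r, 0 < i.1 → i < j → x i < x j) then 1 else 0) with hc
    have hcv : |c| ≤ 1 := by rw [hc]; split_ifs <;> simp
    set q := chi d (x j0) (x j1) with hq
    have hqv : |q ^ 2 - q| ≤ 2 := by
      rcases chi_val d (x j0) (x j1) with h | h | h <;> rw [hq, h] <;> norm_num
    have e : ∑ y ∈ S, c * (if y < x i1 then 1 else 0) * (chi d y (x i1) * (q ^ 2 - q)) =
        c * (q ^ 2 - q) * ∑ u ∈ S.filter (fun u => u < x i1), chi d u (x i1) := by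
      rw [Finset.sum_filter, Finset.mul_sum]
      apply Finset.sum_congr rfl
      intro y _
      split_ifs <;> ring
    rw [e, abs_mul]
    gcongr
    rw [abs_mul]
    calc |c| * |q ^ 2 - q| ≤ 1 * 2 := by gcongr
      _ = 2 := by norm_num
  have b2 : |∑ x ∈ Fintype.piFinset (fun _ : Fin r => S), M x * (chi d (x i0) (x i1) ^ 2 *
      chi d (x j0) (x j1))| ≤ (n : ℝ) ^ (r - 2) * (P : ℝ) ^ 5 := by
    refine err_bound hr S j1 j0 _ (fun v => |∑ u ∈ S.filter (fun u => v < u), chi d u v|) n _ hsn ?_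
      hgt (fun v => by positivity)
    intro x
    simp only [Function.update_self, Function.update_of_ne hi1j, Function.update_of_ne hj01,
      Function.update_of_ne hi0j]
    have : ∀ y, M (Function.update x j1 y) =
        (if (∀ i j : Fin r, j.1 < r - 1 → i < j → x i < x j) then 1 else 0) * (if x j0 < y then 1 else 0) := by
      intro y
      simp only [M, j0, j1, sm_update_last hr x y]
      by_cases h1 : (∀ i j : Fin r, j.1 < r - 1 → i < j → x i < x j) <;>
        by_cases h2 : x ⟨r - 2, by omega⟩ < y <;> simp only [h1, h2, and_true, and_false, if_true, if_false] <;> norm_num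
    simp only [this]
    set c : ℝ := (if (∀ i j : Fin r, j.1 < r - 1 → i < j → x i < x j) then 1 else 0) with hc
    have hcv : |c| ≤ 1 := by rw [hc]; split_ifs <;> simp
    set q := chi d (x i0) (x i1) with hq
    have hqv : |q ^ 2| ≤ 1 := by
      rcases chi_val d (x i0) (x i1) with h | h | h <;> rw [hq, h] <;> norm_num
    have e : ∑ y ∈ S, c * (if x j0 < y then 1 else 0) * (q ^ 2 * chi d (x j0) y) =
        c * q ^ 2 * ∑ u ∈ S.filter (fun u => x j0 < u), chi d u (x j0) := by
      rw [Finset.sum_filter, Finset.mul_sum]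
      apply Finset.sum_congr rfl
      intro y _
      rw [chi_symm d y]
      split_ifs <;> ring
    rw [e, abs_mul]
    apply mul_le_of_le_one_left (abs_nonneg _)
    rw [abs_mul]
    exact mul_le_one₀ hcv (abs_nonneg _) hqv
  have b3 := hzb i0 i1 hi1
  have b4 := hzb j0 j1 hj01.symm
  have hM : ∑ x ∈ Fintype.piFinset (fun _ : Fin r => S), M x = (S.card.choose r : ℝ) := by
    simp only [M]
    rw [sum_ind_eq_card]
    have := card_strictMono' (r := r) S
    rw [← this]
  have hpt : ∀ x : Fin r → ℕ, (1 / 4) * M x + (1 / 4) * (M x * (chi d (x i0) (x i1) *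
      (chi d (x j0) (x j1) ^ 2 - chi d (x j0) (x j1)))) - (1 / 4) * (M x * (chi d (x i0) (x i1) ^ 2 *
      chi d (x j0) (x j1))) - (1 / 4) * z (x i0) (x i1) - (1 / 4) * z (x j0) (x j1) ≤
      (if Good hr d x then (1 : ℝ) else 0) := by
    intro x
    have hG : Good hr d x ↔ StrictMono x ∧ chi d (x i0) (x i1) = 1 ∧ chi d (x j0) (x j1) = -1 := Iff.rfl
    simp only [M, z, hG]
    by_cases hm : StrictMono x
    · rcases chi_val d (x i0) (x i1) with h | h | h <;>
        rcases chi_val d (x j0) (x j1) with h' | h' | h' <;> simp only [hm, h, h'] <;> norm_num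
    · simp only [hm, false_and, if_false]
      have h1 := hz0 (x i0) (x i1)
      have h2 := hz0 (x j0) (x j1)
      simp only [z] at h1 h2
      linarith
  have hsum := Finset.sum_le_sum (s := Fintype.piFinset (fun _ : Fin r => S)) (fun x _ => hpt x)
  rw [sum_ind_eq_card] at hsum
  simp only [Finset.sum_sub_distrib, Finset.sum_add_distrib, ← Finset.mul_sum] at hsum
  rw [hM] at hsum
  have c1 := (abs_le.1 b1).1
  have c2 := (abs_le.1 b2).2
  have c3 := (abs_le.1 b3).2
  have c4 := (abs_le.1 b4).2
  have hpos : 0 ≤ (n : ℝ) ^ (r - 2) * (P : ℝ) ^ 5 := by positivity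
  have : (n : ℝ) ^ (r - 2) * (2 * (P : ℝ) ^ 5) = 2 * ((n : ℝ) ^ (r - 2) * (P : ℝ) ^ 5) := by ring
  rw [this] at c1
  linarith

open Classical in
/-- The dense host graph. -/
noncomputable def HG {r : ℕ} (hr : 3 ≤ r) (d n : ℕ) : RGraph r where
  verts := Finset.range n
  edges := ((Fintype.piFinset (fun _ : Fin r => Finset.range n)).filter (Good hr d)).image
    (fun w => Finset.univ.image w)
  edges_subset := by
    intro e he
    obtain ⟨w, hw, rfl⟩ := Finset.mem_image.1 he
    intro v hv
    obtain ⟨i, _, rfl⟩ := Finset.mem_image.1 hv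
    exact Fintype.mem_piFinset.1 (Finset.mem_filter.1 hw).1 i
  edges_card := by
    intro e he
    obtain ⟨w, hw, rfl⟩ := Finset.mem_image.1 he
    rw [Finset.card_image_of_injective _ (Finset.mem_filter.1 hw).2.1.injective]
    simp

theorem good_of_edge {r : ℕ} (hr : 3 ≤ r) (d n : ℕ) (w : Fin r → ℕ) (hw : StrictMono w)
    (h : Finset.univ.image w ∈ (HG hr d n).edges) : Good hr d w := by
  classical
  obtain ⟨w', hw', he⟩ := Finset.mem_image.1 h
  have hg := (Finset.mem_filter.1 hw').2
  rw [← image_strictMono_inj hg.1 hw he]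
  exact hg

theorem count_HG {r : ℕ} (hr : 3 ≤ r) {d L P : ℕ} (hP : 2 ^ d = P ^ 2) (hL : L = P) (S : Finset ℕ)
    (hS : S ⊆ Finset.range (L * 2 ^ d)) :
    (1 / 4) * (S.card.choose r : ℝ) - 2 * (((L * 2 ^ d : ℕ) : ℝ) ^ (r - 2) * (P : ℝ) ^ 5) ≤
      (((HG hr d (L * 2 ^ d)).edges.filter (fun e => e ⊆ S)).card : ℝ) := by
  classical
  refine (count_good hr hP hL S hS).trans ?_
  norm_cast
  apply Finset.card_le_card_of_injOn (fun w => Finset.univ.image w)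
  · intro w hw
    obtain ⟨h1, h2⟩ := Finset.mem_filter.1 (Finset.mem_coe.1 hw)
    rw [Fintype.mem_piFinset] at h1
    rw [Finset.mem_coe, Finset.mem_filter]
    constructor
    · apply Finset.mem_image_of_mem
      exact Finset.mem_filter.2 ⟨Fintype.mem_piFinset.2 fun i => hS (h1 i), h2⟩
    · intro v hv
      obtain ⟨i, _, rfl⟩ := Finset.mem_image.1 hv
      exact h1 i
  · intro w hw w' hw' h
    have h1 := (Finset.mem_filter.1 (Finset.mem_coe.1 hw)).2.1
    have h2 := (Finset.mem_filter.1 (Finset.mem_coe.1 hw')).2.1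
    exact image_strictMono_inj h1 h2 h

theorem HG_free {r : ℕ} (hr : 3 ≤ r) (N : ℕ) (𝓖 : Finset (Fin (2 * r - 2) → Fin N))
    (h𝓖 : ∀ τ ∈ 𝓖, StrictMono τ)
    (hf : ∀ f : Fin N → ℕ, Function.Injective f → ∃ τ ∈ 𝓖, MonoOn f τ) (d n : ℕ) :
    ¬ IsSubgraph (FG hr N 𝓖 h𝓖) (HG hr d n) := by
  rintro ⟨φ, hinj, -, hedge⟩
  obtain ⟨τ, hτ, hmono⟩ := hf (fun i => φ i.1) (by
    intro a b hab
    exact Fin.ext (hinj (Finset.mem_coe.2 (Finset.mem_range.2 a.2)) (Finset.mem_coe.2 (Finset.mem_range.2 b.2)) hab))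
  have E1 := hedge _ (Finset.mem_union_left _ (Finset.mem_image_of_mem _ hτ))
  have E2 := hedge _ (Finset.mem_union_right _ (Finset.mem_image_of_mem _ hτ))
  rw [Finset.image_image] at E1 E2
  rcases hmono with hm | hm
  · have g1 := good_of_edge hr d n _ (hm.comp (fstI_strictMono hr)) E1
    have g2 := good_of_edge hr d n _ (hm.comp (lstI_strictMono hr)) E2
    have h1 := g1.2.2
    have h2 := g2.2.1
    simp only [Function.comp] at h1 h2
    have a1 : lstI hr ⟨0, by omega⟩ = fstI hr ⟨r - 2, by omega⟩ := Fin.ext (by simp [lstI, fstI])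
    have a2 : lstI hr ⟨1, by omega⟩ = fstI hr ⟨r - 1, by omega⟩ := Fin.ext (by simp [lstI, fstI]; omega)
    rw [a1, a2, h1] at h2
    norm_num at h2
  · have hrev : StrictAnti (Fin.rev : Fin r → Fin r) := fun i j h => Fin.rev_lt_rev.2 h
    have him : ∀ f : Fin r → ℕ, Finset.univ.image f = Finset.univ.image (f ∘ Fin.rev) := by
      intro f
      rw [← Finset.image_image]
      congr 1
      symm
      rw [Finset.eq_univ_iff_forall]
      intro i
      exact Finset.mem_image.2 ⟨Fin.rev i, Finset.mem_univ _, Fin.rev_rev i⟩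
    rw [him] at E1 E2
    have g1 := good_of_edge hr d n _ ((hm.comp_strictMono (fstI_strictMono hr)).comp hrev) E1
    have g2 := good_of_edge hr d n _ ((hm.comp_strictMono (lstI_strictMono hr)).comp hrev) E2
    have h1 := g1.2.1
    have h2 := g2.2.2
    simp only [Function.comp] at h1 h2
    have a1 : lstI hr (Fin.rev ⟨r - 2, by omega⟩) = fstI hr (Fin.rev ⟨0, by omega⟩) :=
      Fin.ext (by simp [lstI, fstI, Fin.rev]; omega)
    have a2 : lstI hr (Fin.rev ⟨r - 1, by omega⟩) = fstI hr (Fin.rev ⟨1, by omega⟩) :=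
      Fin.ext (by simp [lstI, fstI, Fin.rev]; omega)
    rw [a1, a2, h1] at h2
    norm_num at h2

theorem lower {r : ℕ} (hr : 3 ≤ r) (ε : ℝ) (hε : 0 < ε) (m : ℕ) :
    ∃ d n : ℕ, m ≤ n ∧ IsDense (HG hr d n) (1 / 4) ε := by
  obtain ⟨e, he⟩ := pow_unbounded_of_one_lt (max (m : ℝ) (2 * (r : ℝ) ^ r / (ε * ε ^ r))) (one_lt_two)
  have he1 : (m : ℝ) < 2 ^ e := (le_max_left _ _).trans_lt he
  have he2 : 2 * (r : ℝ) ^ r / (ε * ε ^ r) < 2 ^ e := (le_max_right _ _).trans_lt he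
  have hP : 2 ^ (2 * e) = (2 ^ e) ^ 2 := by rw [← pow_mul, mul_comm]
  have hm : m ≤ 2 ^ e := by exact_mod_cast he1.le
  refine ⟨2 * e, 2 ^ e * 2 ^ (2 * e), hm.trans (Nat.le_mul_of_pos_right _ (by positivity)), ?_⟩
  intro S hS hcard
  have hcnt := count_HG hr hP rfl S hS
  have hv : (HG hr (2 * e) (2 ^ e * 2 ^ (2 * e))).verts.card = 2 ^ e * 2 ^ (2 * e) := Finset.card_range _
  rw [hv] at hcard
  rw [sub_mul]
  by_cases hs : S.card < r
  · rw [Nat.choose_eq_zero_of_lt hs]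
    simp
  have hs' : r ≤ S.card := by omega
  refine le_trans (sub_le_sub_left ?_ _) hcnt
  have hch := pow_le_choose_mul S.card r hs'
  have hch' : (S.card : ℝ) ^ r ≤ (S.card.choose r : ℝ) * (r : ℝ) ^ r := by exact_mod_cast hch
  set P : ℝ := 2 ^ e with hPdef
  have hPpos : 0 < P := by positivity
  have hn : ((2 ^ e * 2 ^ (2 * e) : ℕ) : ℝ) = P ^ 3 := by
    push_cast
    rw [hPdef, mul_comm 2 e, pow_mul]
    ring
  have h2e : ((2 ^ e : ℕ) : ℝ) = P := by push_cast; rfl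
  rw [hn] at hcard ⊢
  rw [h2e]
  have hpow : (ε * P ^ 3) ^ r ≤ (S.card.choose r : ℝ) * (r : ℝ) ^ r :=
    (pow_le_pow_left₀ (by positivity) hcard r).trans hch'
  rw [div_lt_iff₀ (by positivity)] at he2
  have key : (P ^ 3) ^ (r - 2) * P ^ 5 * P = (P ^ 3) ^ r := by
    obtain ⟨k, rfl⟩ : ∃ k, r = k + 2 := ⟨r - 2, by omega⟩
    rw [Nat.add_sub_cancel]
    ring
  have hrpos : (0 : ℝ) < (r : ℝ) ^ r := by
    have : (0 : ℝ) < r := by exact_mod_cast (by omega : 0 < r)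
    positivity
  set X := (P ^ 3) ^ (r - 2) * P ^ 5 with hX
  set C := (S.card.choose r : ℝ)
  rw [mul_pow, ← key] at hpow
  have hXpos : 0 < X := by positivity
  have hεr : 0 < ε ^ r := by positivity
  -- combine the two estimates
  have h3 : (2 * X) * (r : ℝ) ^ r ≤ (ε * C) * (r : ℝ) ^ r := by
    calc (2 * X) * (r : ℝ) ^ r = X * (2 * (r : ℝ) ^ r) := by ring
      _ ≤ X * (P * (ε * ε ^ r)) := by gcongr
      _ = ε * (ε ^ r * (X * P)) := by ring
      _ ≤ ε * (C * (r : ℝ) ^ r) := by gcongr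
      _ = _ := by ring
  exact le_of_mul_le_mul_right h3 hrpos

/-- For every r ≥ 3 there is an r-graph F with uniform Turán density 1/4. -/
theorem exists_rgraph_uniform_turan_density_one_quarter (r : ℕ) (hr : 3 ≤ r) :
    ∃ F : RGraph r,
      (∃ H : ℕ → RGraph r, LocallyDense H (1 / 4 : ℝ) ∧ ∀ n, ¬ IsSubgraph F (H n)) ∧
      ∀ ε : ℝ, 0 < ε →
        ¬ ∃ H : ℕ → RGraph r, LocallyDense H (1 / 4 + ε) ∧ ∀ n, ¬ IsSubgraph F (H n) := by
  obtain ⟨N, 𝓖, h𝓖, hsh, hf⟩ := exists_G (2 * r - 2) (by omega)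
  refine ⟨FG hr N 𝓖 h𝓖, ?_, ?_⟩
  · choose d n hn hd using fun k : ℕ => lower hr (1 / ((k : ℝ) + 1)) (by positivity) k
    refine ⟨fun k => HG hr (d k) (n k), ⟨fun k => 1 / ((k : ℝ) + 1), fun k => by positivity,
      tendsto_one_div_add_atTop_nhds_zero_nat, ?_, hd⟩, fun k => HG_free hr N 𝓖 h𝓖 hf _ _⟩
    refine Filter.tendsto_atTop_mono (fun k => ?_) Filter.tendsto_id
    show k ≤ (Finset.range (n k)).card
    rw [Finset.card_range]
    exact hn k
  · rintro ε hε ⟨H, ⟨δ, hδ, hδ0, hv, hd⟩, hfree⟩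
    obtain ⟨κ, hκ, n0, hup⟩ := upper hr N 𝓖 h𝓖 hsh (ε / 2) (by positivity)
    have h1 := hδ0.eventually (gt_mem_nhds (show (0 : ℝ) < min κ (ε / 2) from lt_min hκ (by positivity)))
    have h2 := hv.eventually (Filter.eventually_ge_atTop n0)
    obtain ⟨k, hk1, hk2⟩ := (h1.and h2).exists
    apply hfree k
    apply hup (H k) hk2
    intro S hS hSc
    have hk3 : δ k < κ := hk1.trans_le (min_le_left _ _)
    have hk4 : δ k < ε / 2 := hk1.trans_le (min_le_right _ _)
    refine le_trans ?_ (hd k S hS (le_trans ?_ hSc))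
    · apply mul_le_mul_of_nonneg_right _ (Nat.cast_nonneg _)
      linarith
    · gcongr

end UTD
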